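/- Suppose Φ : ℝ × ℝ^d × ℝ^d → ℂ satisfies sup_{s,x,y} |∂_x^α ∂_y^β Φ(s,x,y)| ≤ D for all multi-indices |α|, |β| ≤ 10d and is supported in {|s| < L^{2γ}}. Then for all λ with 1 ≤ λ ≤ (log L)⁴, uniformly in (a, b, ξ, ζ) ∈ ℝ^{4d}: ∫_ℝ | ∑_{(x,y) ∈ ℤ_L^d × ℤ_L^d} Φ(s,x,y) χ₀((x−a)/λ) χ₀((y−b)/λ) e(x·ξ + y·ζ + s(x·y)) | ds ≤ C·D·λ^{4d}·L^{2d}. -/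

import Mathlib

open MeasureTheory
open scoped RealInnerProductSpace ENNReal NNReal BigOperators

noncomputable section

/-- `e(z) = e^{2πiz}`. -/
def efun (t : ℝ) : ℂ := Complex.exp (2 * (Real.pi : ℂ) * Complex.I * (t : ℂ))

/-- The rescaled lattice `ℤ_L^d = (L⁻¹ℤ)^d` inside `ℝ^d`. -/
def ZLat (d : ℕ) (L : ℝ) : Set (EuclideanSpace ℝ (Fin d)) :=
  {x | ∀ i, ∃ m : ℤ, x i = (m : ℝ) / L}

/-- Product cutoff `χ₀(z) = χ₀(z¹)⋯χ₀(z^d)` on `ℝ^d`. -/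
def cutoffProd (d : ℕ) (χ : ℝ → ℝ) (z : EuclideanSpace ℝ (Fin d)) : ℝ :=
  ∏ i, χ (z i)

/-- Directional derivative of a function along a vector. -/
def pderivAlong {X : Type*} [NormedAddCommGroup X] [NormedSpace ℝ X]
    (v : X) (f : X → ℂ) : X → ℂ :=
  fun z => fderiv ℝ f z v

/-- Iterated directional (partial) derivatives along a list of directions. -/
def pderivList {X : Type*} [NormedAddCommGroup X] [NormedSpace ℝ X]
    (l : List X) (f : X → ℂ) : X → ℂ :=
  l.foldr pderivAlong f

/-- The multi-index derivative bounds `sup_{s,x,y} |∂_x^α ∂_y^β Φ(s,x,y)| ≤ D`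
for all multi-indices `|α|, |β| ≤ 10d`. -/
def PhiDerivBound (d : ℕ) (D : ℝ)
    (Φ : ℝ → EuclideanSpace ℝ (Fin d) → EuclideanSpace ℝ (Fin d) → ℂ) : Prop :=
  ∀ lx ly : List (Fin d), lx.length ≤ 10 * d → ly.length ≤ 10 * d →
    ∀ (s : ℝ) (x y : EuclideanSpace ℝ (Fin d)),
      ‖pderivList (lx.map fun i => EuclideanSpace.single i (1 : ℝ))
          (fun x' => pderivList (ly.map fun i => EuclideanSpace.single i (1 : ℝ))
            (fun y' => Φ s x' y') y) x‖ ≤ D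

/-- The lattice sum over `ℤ_L^d × ℤ_L^d`. -/
def latSum (d : ℕ) (χ : ℝ → ℝ)
    (Φ : ℝ → EuclideanSpace ℝ (Fin d) → EuclideanSpace ℝ (Fin d) → ℂ)
    (lam L s : ℝ) (a b ξ ζ : EuclideanSpace ℝ (Fin d)) : ℂ :=
  ∑' q : ZLat d L × ZLat d L,
    (fun x y : EuclideanSpace ℝ (Fin d) =>
        Φ s x y *
          ((cutoffProd d χ (lam⁻¹ • (x - a)) * cutoffProd d χ (lam⁻¹ • (y - b)) : ℝ) : ℂ) *
          efun (⟪x, ξ⟫ + ⟪y, ζ⟫ + s * ⟪x, y⟫))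
      (↑q.1) (↑q.2)

/-- The divisor bound `d(n) ≪_ε n^ε`. -/
theorem exists_card_divisors_le_rpow {ε : ℝ} (hε : 0 < ε) :
    ∃ C : ℝ, 1 ≤ C ∧ ∀ n : ℕ, n ≠ 0 → (n.divisors.card : ℝ) ≤ C * (n : ℝ) ^ ε := by
  obtain ⟨K, hK⟩ := exists_nat_gt ((2 : ℝ) ^ (1 / ε))
  set c : ℝ := 1 + 1 / (ε * Real.log 2) with hc
  have hl2 : 0 < Real.log 2 := Real.log_pos (by norm_num)
  have hc1 : 1 ≤ c := by
    have : 0 < 1 / (ε * Real.log 2) := by positivity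
    linarith
  have hsmall : ∀ p a : ℕ, 2 ≤ p → (a + 1 : ℝ) ≤ c * ((p : ℝ) ^ a) ^ ε := by
    intro p a hp
    have h2p : (2 : ℝ) ≤ p := by exact_mod_cast hp
    have h1 : ((2 : ℝ) ^ a) ^ ε ≤ ((p : ℝ) ^ a) ^ ε := by gcongr
    have h2 : ((2 : ℝ) ^ a) ^ ε = Real.exp (a * (ε * Real.log 2)) := by
      rw [← Real.rpow_natCast, ← Real.rpow_mul (by norm_num), Real.rpow_def_of_pos (by norm_num)]
      congr 1; ring
    have h3 := Real.add_one_le_exp (a * (ε * Real.log 2))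
    have h4 : (0 : ℝ) ≤ a := Nat.cast_nonneg a
    have h5 : (1 : ℝ) ≤ ((2 : ℝ) ^ a) ^ ε := by
      rw [h2]; exact Real.one_le_exp (by positivity)
    have h6 : (a : ℝ) ≤ 1 / (ε * Real.log 2) * ((2 : ℝ) ^ a) ^ ε := by
      rw [h2, div_mul_eq_mul_div, le_div_iff₀ (by positivity)]
      linarith
    calc (a + 1 : ℝ) ≤ c * ((2 : ℝ) ^ a) ^ ε := by rw [hc, add_mul]; linarith
      _ ≤ _ := by gcongr
  have hlarge : ∀ p a : ℕ, K ≤ p → (a + 1 : ℝ) ≤ ((p : ℝ) ^ a) ^ ε := by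
    intro p a hp
    have hKp : (2 : ℝ) ^ (1 / ε) ≤ p := hK.le.trans (by exact_mod_cast hp)
    have h1 : (2 : ℝ) ≤ (p : ℝ) ^ ε := by
      calc (2 : ℝ) = ((2 : ℝ) ^ (1 / ε)) ^ ε := by
            rw [← Real.rpow_mul (by norm_num), one_div_mul_cancel hε.ne', Real.rpow_one]
        _ ≤ _ := by gcongr
    have h2 : ((p : ℝ) ^ a) ^ ε = ((p : ℝ) ^ ε) ^ a := by
      rw [← Real.rpow_natCast, ← Real.rpow_natCast, ← Real.rpow_mul (by positivity),
        ← Real.rpow_mul (by positivity), mul_comm]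
    rw [h2]
    calc (a + 1 : ℝ) ≤ 2 ^ a := by exact_mod_cast Nat.lt_two_pow_self
      _ ≤ _ := by gcongr
  refine ⟨c ^ K, one_le_pow₀ hc1, fun n hn => ?_⟩
  rw [Nat.card_divisors hn]
  have hn' : (n : ℝ) ^ ε = ∏ p ∈ n.primeFactors, ((p : ℝ) ^ n.factorization p) ^ ε := by
    rw [Real.finsetProd_rpow _ _ (fun p _ => by positivity)]
    congr 1
    conv_lhs => rw [← Nat.prod_factorization_pow_eq_self hn]
    rw [Finsupp.prod, Nat.support_factorization]
    push_cast
    rfl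
  have hf : ∏ p ∈ n.primeFactors, (if p < K then c else 1) ≤ c ^ K := by
    rw [Finset.prod_ite, Finset.prod_const, Finset.prod_const_one, mul_one]
    refine pow_le_pow_right₀ hc1 ?_
    calc _ ≤ (Finset.range K).card := Finset.card_le_card (fun p hp => by
            simp only [Finset.mem_filter] at hp; simpa using hp.2)
      _ = K := Finset.card_range K
  calc ((∏ x ∈ n.primeFactors, (n.factorization x + 1) : ℕ) : ℝ)
      = ∏ x ∈ n.primeFactors, ((n.factorization x : ℝ) + 1) := by push_cast; rfl
    _ ≤ ∏ p ∈ n.primeFactors,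
        ((if p < K then c else 1) * ((p : ℝ) ^ n.factorization p) ^ ε) := by
        refine Finset.prod_le_prod (fun p _ => by positivity) (fun p hp => ?_)
        split_ifs with h
        · exact hsmall p _ (Nat.prime_of_mem_primeFactors hp).two_le
        · rw [one_mul]; exact hlarge p _ (not_lt.mp h)
    _ = (∏ p ∈ n.primeFactors, (if p < K then c else 1)) * (n : ℝ) ^ ε := by
        rw [Finset.prod_mul_distrib, hn']
    _ ≤ _ := by gcongr

theorem efun_add (s t : ℝ) : efun (s + t) = efun s * efun t := by
  rw [efun, efun, efun, ← Complex.exp_add]; congr 1; push_cast; ring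

theorem norm_efun (t : ℝ) : ‖efun t‖ = 1 := by
  rw [efun, show 2 * (Real.pi : ℂ) * Complex.I * (t : ℂ) =
      ((2 * Real.pi * t : ℝ) : ℂ) * Complex.I by
    push_cast; ring, Complex.norm_exp_ofReal_mul_I]

theorem efun_int (n : ℤ) : efun n = 1 := by
  rw [efun, Complex.exp_eq_one_iff]; exact ⟨n, by push_cast; ring⟩

/-- The distance to the nearest integer is dominated by `|1 - e(α)|`. -/
theorem four_mul_abs_sub_round_le (α : ℝ) : 4 * |α - round α| ≤ ‖efun α - 1‖ := by
  set t := α - round α with ht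
  have h1 : efun α = efun t := by
    have : α = t + (round α : ℤ) := by rw [ht]; ring
    conv_lhs => rw [this, efun_add, efun_int, mul_one]
  have h2 : |t| ≤ 1 / 2 := abs_sub_round α
  have h3 : efun t = Complex.exp (Complex.I * ((2 * Real.pi * t : ℝ) : ℂ)) := by
    rw [efun]; congr 1; push_cast; ring
  rw [h1, h3, Complex.norm_exp_I_mul_ofReal_sub_one, norm_mul, Real.norm_eq_abs, Real.norm_eq_abs,
    abs_of_pos (by norm_num : (0 : ℝ) < 2), show 2 * Real.pi * t / 2 = Real.pi * t by ring]
  have h4 : |Real.sin (Real.pi * t)| = Real.sin (Real.pi * |t|) := by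
    rcases abs_cases t with ⟨h, h'⟩ | ⟨h, h'⟩
    · rw [h, abs_of_nonneg]
      apply Real.sin_nonneg_of_nonneg_of_le_pi (by positivity)
      nlinarith [Real.pi_pos]
    · rw [h, mul_neg, Real.sin_neg, abs_of_nonpos]
      have := Real.sin_nonneg_of_nonneg_of_le_pi (x := Real.pi * (-t))
        (mul_nonneg Real.pi_pos.le (by linarith)) (by nlinarith [Real.pi_pos])
      rw [mul_neg, Real.sin_neg] at this
      linarith
  rw [h4]
  have h5 := Real.mul_le_sin (x := Real.pi * |t|) (by positivity) (by nlinarith [Real.pi_pos])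
  have h6 : 2 / Real.pi * (Real.pi * |t|) = 2 * |t| := by field_simp
  linarith

theorem sum_Icc_int_eq_sum_range {M : Type*} [AddCommMonoid M] (f : ℤ → M) (p q : ℤ) :
    ∑ n ∈ Finset.Icc p q, f n = ∑ i ∈ Finset.range (q + 1 - p).toNat, f (p + i) := by
  rw [show Finset.Icc p q = (Finset.range (q + 1 - p).toNat).map
    (Nat.castEmbedding.trans <| addLeftEmbedding p) from rfl, Finset.sum_map]
  rfl

theorem norm_geom_sum_efun_le_card (p q : ℤ) (α β : ℝ) :
    ‖∑ n ∈ Finset.Icc p q, efun (n * α + β)‖ ≤ (Finset.Icc p q).card := by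
  refine (norm_sum_le _ _).trans ?_
  simp [norm_efun]

theorem norm_geom_sum_efun_mul_le (p q : ℤ) (α β : ℝ) :
    ‖∑ n ∈ Finset.Icc p q, efun (n * α + β)‖ * (2 * |α - round α|) ≤ 1 := by
  set S := ∑ n ∈ Finset.Icc p q, efun (n * α + β) with hS
  have h1 : ‖S * (efun α - 1)‖ ≤ 2 := by
    have h2 : S * (efun α - 1)
        = efun ((p + ((q + 1 - p).toNat : ℕ)) * α + β) - efun (p * α + β) := by
      rw [hS, sum_Icc_int_eq_sum_range, Finset.sum_mul]
      have := Finset.sum_range_sub (fun i : ℕ => efun ((p + (i : ℝ)) * α + β)) (q + 1 - p).toNat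
      simp only [Nat.cast_zero, add_zero] at this
      rw [← this]
      refine Finset.sum_congr rfl fun i _ => ?_
      rw [mul_sub, mul_one, ← efun_add]
      push_cast
      congr 2
      ring
    rw [h2]
    refine (norm_sub_le _ _).trans ?_
    rw [norm_efun, norm_efun]; norm_num
  rw [norm_mul] at h1
  have h3 := four_mul_abs_sub_round_le α
  nlinarith [norm_nonneg S]

/-- Dyadic form of `|∑ e(nα)| ≤ min(2^J, 1 / (2‖α‖))`. -/
theorem norm_geom_sum_efun_le_dyadic (J : ℕ) (p q : ℤ) (α β : ℝ)
    (hcard : (Finset.Icc p q).card ≤ 2 ^ J) :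
    ‖∑ n ∈ Finset.Icc p q, efun (n * α + β)‖ ≤
      ∑ j ∈ Finset.range (J + 1),
        (2 : ℝ) ^ (j + 1) * (if |α - round α| ≤ (1 / 2) ^ j then 1 else 0) := by
  classical
  have hex : ∃ j ∈ Finset.range (J + 1), |α - round α| ≤ (1 / 2 : ℝ) ^ j ∧
      ‖∑ n ∈ Finset.Icc p q, efun (n * α + β)‖ ≤ (2 : ℝ) ^ (j + 1) := by
    by_cases hJ : |α - round α| ≤ (1 / 2 : ℝ) ^ J
    · refine ⟨J, by simp, hJ, (norm_geom_sum_efun_le_card p q α β).trans ?_⟩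
      calc ((Finset.Icc p q).card : ℝ) ≤ 2 ^ J := by exact_mod_cast hcard
        _ ≤ 2 ^ (J + 1) := pow_le_pow_right₀ (by norm_num) (by omega)
    · have hE : ∃ j, ¬ |α - round α| ≤ (1 / 2 : ℝ) ^ j := ⟨J, hJ⟩
      have h0 : Nat.find hE ≠ 0 := by
        intro h
        apply Nat.find_spec hE
        rw [h]
        have := abs_sub_round α
        norm_num; linarith
      obtain ⟨k, hk⟩ := Nat.exists_eq_succ_of_ne_zero h0
      have hk1 : ¬ |α - round α| ≤ (1 / 2 : ℝ) ^ (k + 1) := by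
        have := Nat.find_spec hE; rwa [hk] at this
      have hk2 : |α - round α| ≤ (1 / 2 : ℝ) ^ k := by
        by_contra hcon; have := Nat.find_min' hE hcon; omega
      have hkJ : k < J + 1 := by have := Nat.find_min' hE hJ; omega
      refine ⟨k, by simpa using hkJ, hk2, ?_⟩
      have h2 := norm_geom_sum_efun_mul_le p q α β
      have h3 : (2 : ℝ) ^ (k + 1) * (1 / 2) ^ (k + 1) = 1 := by rw [← mul_pow]; norm_num
      have h4 : (0 : ℝ) < (1 / 2) ^ (k + 1) := by positivity
      by_contra! hcon
      have h5 : (2 : ℝ) ^ (k + 1) * (1 / 2) ^ (k + 1) <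
          ‖∑ n ∈ Finset.Icc p q, efun (n * α + β)‖ * |α - round α| :=
        mul_lt_mul'' hcon (not_le.mp hk1) (by positivity) (by positivity)
      nlinarith
  obtain ⟨j, hj, hj1, hj2⟩ := hex
  refine hj2.trans ?_
  calc (2 : ℝ) ^ (j + 1) = 2 ^ (j + 1) * (if |α - round α| ≤ (1 / 2) ^ j then 1 else 0) := by
        rw [if_pos hj1, mul_one]
    _ ≤ _ := Finset.single_le_sum (f := fun j => (2 : ℝ) ^ (j + 1) *
        (if |α - round α| ≤ (1 / 2) ^ j then 1 else 0)) (fun i _ => by positivity) hj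

/-- The number of `0 ≤ r < 2 ^ J` such that `θ r` lies within `2 ^ (1 - j)` of an integer. -/
def nearCount (J j : ℕ) (θ : ℝ) : ℕ :=
  ((Finset.range (2 ^ J)).filter
    (fun r : ℕ => |θ * r - round (θ * r)| ≤ 2 * (1 / 2 : ℝ) ^ j)).card

/-- A bound, uniform in the linear phases, for the bilinear sums `∑∑ e(θmn + cm + c'n)` over
rectangles with sides at most `2 ^ J`. -/
def bilinearBound (J : ℕ) (θ : ℝ) : ℝ :=
  ∑ j ∈ Finset.range (J + 1), (2 : ℝ) ^ (j + 1) * nearCount J j θ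

theorem card_near_translate_le (J j : ℕ) (θ c : ℝ) (p q : ℤ)
    (hcard : (Finset.Icc p q).card ≤ 2 ^ J) :
    ((Finset.Icc p q).filter
      (fun m : ℤ => |(θ * m + c) - round (θ * m + c)| ≤ (1 / 2 : ℝ) ^ j)).card
      ≤ nearCount J j θ := by
  set F := (Finset.Icc p q).filter
      (fun m : ℤ => |(θ * m + c) - round (θ * m + c)| ≤ (1 / 2 : ℝ) ^ j) with hF
  rcases F.eq_empty_or_nonempty with h | h
  · simp [h]
  set m₀ := F.min' h
  have hm₀ : m₀ ∈ F := F.min'_mem h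
  refine Finset.card_le_card_of_injOn (fun m => (m - m₀).toNat) ?_ ?_
  · intro m hm
    have hmin : m₀ ≤ m := F.min'_le m hm
    simp only [hF, Finset.coe_filter, Set.mem_ofPred_eq, Finset.mem_filter, Finset.mem_Icc]
      at hm hm₀
    rw [Int.card_Icc] at hcard
    have hcast : (((m - m₀).toNat : ℕ) : ℝ) = m - m₀ := by
      have : (((m - m₀).toNat : ℕ) : ℤ) = m - m₀ := Int.toNat_of_nonneg (by omega)
      exact_mod_cast this
    have hlt : (m - m₀).toNat < 2 ^ J := by omega
    simp only [Finset.coe_filter, Finset.mem_range, Set.mem_ofPred_eq, hlt, true_and]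
    refine (round_le _ (round (θ * m + c) - round (θ * m₀ + c))).trans ?_
    rw [hcast]
    have := abs_sub ((θ * m + c) - round (θ * m + c)) ((θ * m₀ + c) - round (θ * m₀ + c))
    push_cast
    calc _ = |((θ * m + c) - round (θ * m + c)) - ((θ * m₀ + c) - round (θ * m₀ + c))| := by
          congr 1; ring
      _ ≤ _ := by linarith [hm.2, hm₀.2]
  · intro m hm m' hm' hmm
    have h1 : m₀ ≤ m := F.min'_le m hm
    have h2 : m₀ ≤ m' := F.min'_le m' hm'
    simp only at hmm
    omega

theorem norm_bilinear_sum_le (J : ℕ) (θ ξ ζ : ℝ) (p q p' q' : ℤ)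
    (hcard : (Finset.Icc p q).card ≤ 2 ^ J) (hcard' : (Finset.Icc p' q').card ≤ 2 ^ J) :
    ‖∑ m ∈ Finset.Icc p q, ∑ n ∈ Finset.Icc p' q', efun (m * ξ + n * ζ + θ * (m * n))‖
      ≤ bilinearBound J θ := by
  calc _ ≤ ∑ m ∈ Finset.Icc p q, ‖∑ n ∈ Finset.Icc p' q', efun (n * (θ * m + ζ) + m * ξ)‖ := by
        refine (norm_sum_le _ _).trans (le_of_eq (Finset.sum_congr rfl fun m _ => ?_))
        congr 1
        refine Finset.sum_congr rfl fun n _ => ?_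
        congr 1; ring
    _ ≤ ∑ m ∈ Finset.Icc p q, ∑ j ∈ Finset.range (J + 1), (2 : ℝ) ^ (j + 1) *
          (if |(θ * m + ζ) - round (θ * m + ζ)| ≤ (1 / 2) ^ j then 1 else 0) :=
        Finset.sum_le_sum fun m _ => norm_geom_sum_efun_le_dyadic J p' q' _ _ hcard'
    _ = ∑ j ∈ Finset.range (J + 1), (2 : ℝ) ^ (j + 1) * (((Finset.Icc p q).filter
      (fun m : ℤ => |(θ * m + ζ) - round (θ * m + ζ)| ≤ (1 / 2 : ℝ) ^ j)).card : ℝ) := by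
        rw [Finset.sum_comm]
        refine Finset.sum_congr rfl fun j _ => ?_
        rw [← Finset.mul_sum, Finset.sum_boole]
    _ ≤ _ := by
        refine Finset.sum_le_sum fun j _ => ?_
        gcongr
        exact card_near_translate_le J j θ ζ p q hcard

theorem integral_efun_int_mul (k : ℤ) :
    ∫ θ in (-1 : ℝ)..1, efun (k * θ) = if k = 0 then 2 else 0 := by
  split_ifs with hk
  · subst hk
    simp [efun]
    norm_num
  · have hc : 2 * (Real.pi : ℂ) * Complex.I * k ≠ 0 := by
      simp [Real.pi_ne_zero, hk]
    have h1 : (fun θ : ℝ => efun (k * θ)) =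
        fun θ : ℝ => Complex.exp (2 * (Real.pi : ℂ) * Complex.I * k * θ) := by
      funext θ; rw [efun]; congr 1; push_cast; ring
    rw [h1, integral_exp_mul_complex hc]
    have h2 := efun_int k
    have h3 := efun_int (-k)
    rw [efun] at h2 h3
    rw [show 2 * (Real.pi : ℂ) * Complex.I * k * (1 : ℝ) =
        2 * Real.pi * Complex.I * ((k : ℝ) : ℂ) by
      push_cast; ring,
      show 2 * (Real.pi : ℂ) * Complex.I * k * (-1 : ℝ) =
        2 * Real.pi * Complex.I * (((-k : ℤ) : ℝ) : ℂ) by push_cast; ring, h2, h3]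
    simp

theorem continuous_efun : Continuous efun := by unfold efun; fun_prop

theorem conj_efun (t : ℝ) : (starRingEnd ℂ) (efun t) = efun (-t) := by
  rw [efun, efun, ← Complex.exp_conj]
  congr 1
  simp [map_ofNat (starRingEnd ℂ) 2]

theorem sum_efun_mul_conj {ι : Type*} (T : Finset ι) (φ : ι → ℝ) :
    (((‖∑ x ∈ T, efun (φ x)‖ ^ 2 : ℝ)) : ℂ) = ∑ x ∈ T, ∑ y ∈ T, efun (φ x - φ y) := by
  rw [Complex.ofReal_pow, ← Complex.mul_conj', map_sum, Finset.sum_mul_sum]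
  refine Finset.sum_congr rfl fun x _ => Finset.sum_congr rfl fun y _ => ?_
  rw [conj_efun, ← efun_add, sub_eq_add_neg]

theorem integral_norm_sum_efun_sq {ι : Type*} (T : Finset ι) (φ : ι → ℤ) :
    ∫ θ in (-1 : ℝ)..1, ‖∑ x ∈ T, efun (φ x * θ)‖ ^ 2 =
      2 * ∑ x ∈ T, ((T.filter fun y => φ y = φ x).card : ℝ) := by
  have h : ((∫ θ in (-1 : ℝ)..1, ‖∑ x ∈ T, efun (φ x * θ)‖ ^ 2 : ℝ) : ℂ) =
      ((2 * ∑ x ∈ T, ((T.filter fun y => φ y = φ x).card : ℝ) : ℝ) : ℂ) := by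
    rw [← intervalIntegral.integral_ofReal]
    simp_rw [sum_efun_mul_conj]
    rw [intervalIntegral.integral_finsetSum fun x _ => by
      apply Continuous.intervalIntegrable
      exact continuous_finsetSum _ fun y _ => continuous_efun.comp (by fun_prop)]
    push_cast
    rw [Finset.mul_sum]
    refine Finset.sum_congr rfl fun x _ => ?_
    rw [intervalIntegral.integral_finsetSum fun y _ => by
      apply Continuous.intervalIntegrable
      exact continuous_efun.comp (by fun_prop)]
    have : ∀ y, ∫ θ in (-1 : ℝ)..1, efun (φ x * θ - φ y * θ) = if φ y = φ x then 2 else 0 := by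
      intro y
      have := integral_efun_int_mul (φ x - φ y)
      simp only [sub_eq_zero, eq_comm (a := φ x)] at this
      rw [← this]
      congr 1; funext θ; congr 1; push_cast; ring
    simp_rw [this]
    rw [← Finset.sum_filter, Finset.sum_const, nsmul_eq_mul, mul_comm]
  exact_mod_cast h

/-- The number of solutions of `(n - n') r = (l - l') s` with `1 ≤ r, s < N` and
`0 ≤ n, n', l, l' < M`. -/
theorem sum_card_bilinear_fiber_le (N M : ℕ) (D : ℝ)
    (hD : ∀ n : ℕ, n ≠ 0 → n ≤ N * M → (n.divisors.card : ℝ) ≤ D) :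
    ∑ x ∈ Finset.Ico 1 N ×ˢ (Finset.range M ×ˢ Finset.range M),
      (((Finset.Ico 1 N ×ˢ (Finset.range M ×ˢ Finset.range M)).filter
        fun y : ℕ × ℕ × ℕ => ((y.2.1 : ℤ) - y.2.2) * y.1 = ((x.2.1 : ℤ) - x.2.2) * x.1).card : ℝ)
      ≤ (N * M : ℝ) ^ 2 + N * M ^ 3 * D := by
  set T := Finset.Ico 1 N ×ˢ (Finset.range M ×ˢ Finset.range M) with hT
  set φ : ℕ × ℕ × ℕ → ℤ := fun y => ((y.2.1 : ℤ) - y.2.2) * y.1 with hφ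
  have hzero : ((T.filter fun y => φ y = 0).card : ℝ) ≤ N * M := by
    have : (T.filter fun y => φ y = 0).card ≤ (Finset.range N ×ˢ Finset.range M).card := by
      refine Finset.card_le_card_of_injOn (fun y => (y.1, y.2.1)) ?_ ?_
      · rintro ⟨r, n, n'⟩ hy
        simp only [hT, Finset.coe_filter, Set.mem_ofPred_eq, Finset.mem_product, Finset.mem_Ico,
          Finset.mem_range] at hy
        simp only [Finset.coe_product, Set.mem_prod, Finset.mem_coe, Finset.mem_range]
        omega
      · rintro ⟨r, n, n'⟩ hy ⟨s, l, l'⟩ hz hyz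
        simp only [hT, hφ, Finset.coe_filter, Set.mem_ofPred_eq, Finset.mem_product,
          Finset.mem_Ico, Finset.mem_range, mul_eq_zero] at hy hz
        simp only [Prod.mk.injEq] at hyz ⊢
        omega
    rw [Finset.card_product, Finset.card_range, Finset.card_range] at this
    exact_mod_cast this
  have hnz : ∀ x ∈ T, φ x ≠ 0 → ((T.filter fun y => φ y = φ x).card : ℝ) ≤ M * D := by
    rintro ⟨r, n, n'⟩ hx hx0
    set v := φ (r, n, n') with hv
    have hvle : v.natAbs ≤ N * M := by
      simp only [hT, Finset.mem_product, Finset.mem_Ico, Finset.mem_range] at hx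
      rw [hv, hφ]
      simp only [Int.natAbs_mul, Int.natAbs_natCast]
      rw [mul_comm]
      exact Nat.mul_le_mul (by omega) (by omega)
    have h1 : (T.filter fun y => φ y = v).card ≤ (v.natAbs.divisors ×ˢ Finset.range M).card := by
      refine Finset.card_le_card_of_injOn (fun y => (y.1, y.2.2)) ?_ ?_
      · rintro ⟨s, l, l'⟩ hy
        simp only [hT, Finset.coe_filter, Set.mem_ofPred_eq, Finset.mem_product, Finset.mem_Ico,
          Finset.mem_range] at hy
        simp only [Finset.coe_product, Set.mem_prod, Finset.mem_coe, Finset.mem_range,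
          Nat.mem_divisors]
        refine ⟨⟨?_, by omega⟩, by omega⟩
        rw [← hy.2, hφ]
        simp only [Int.natAbs_mul, Int.natAbs_natCast]
        exact Dvd.intro_left _ rfl
      · rintro ⟨s, l, l'⟩ hy ⟨s', k, k'⟩ hz hyz
        simp only [hT, hφ, Finset.coe_filter, Set.mem_ofPred_eq, Finset.mem_product,
          Finset.mem_Ico, Finset.mem_range] at hy hz
        simp only [Prod.mk.injEq] at hyz ⊢
        obtain ⟨rfl, rfl⟩ := hyz
        have h2 := mul_right_cancel₀ (by have := hy.1.1.1; positivity) (hy.2.trans hz.2.symm)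
        omega
    rw [Finset.card_product, Finset.card_range] at h1
    calc ((T.filter fun y => φ y = v).card : ℝ) ≤ (v.natAbs.divisors.card : ℝ) * M := by
          exact_mod_cast h1
      _ ≤ D * M := by gcongr; exact hD _ (by omega) hvle
      _ = _ := mul_comm _ _
  have hD0 : 0 ≤ N * M ^ 3 * D := by
    by_cases h : N * M = 0
    · rcases Nat.mul_eq_zero.mp h with h | h <;> simp [h]
    · have := (Nat.cast_nonneg _).trans (hD 1 one_ne_zero (Nat.one_le_iff_ne_zero.mpr h))
      positivity
  have hcT : (T.card : ℝ) ≤ N * M ^ 2 := by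
    rw [hT, Finset.card_product, Finset.card_product, Finset.card_range, Nat.card_Ico]
    push_cast
    rw [← sq]
    gcongr
    omega
  change ∑ x ∈ T, ((T.filter fun y => φ y = φ x).card : ℝ) ≤ _
  rw [← Finset.sum_filter_add_sum_filter_not T (fun x => φ x = 0)]
  refine add_le_add ?_ ?_
  · calc _ ≤ ∑ x ∈ T.filter fun x => φ x = 0, (N * M : ℝ) := by
          refine Finset.sum_le_sum fun x hx => ?_
          rw [(Finset.mem_filter.mp hx).2]; exact hzero
      _ ≤ _ := by
          rw [Finset.sum_const, nsmul_eq_mul, sq]; gcongr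
  · rcases (T.filter fun x => ¬ φ x = 0).eq_empty_or_nonempty with h | ⟨x₀, hx₀⟩
    · rw [h, Finset.sum_empty]; exact hD0
    · have hMD : 0 ≤ M * D := by
        obtain ⟨h1, h2⟩ := Finset.mem_filter.mp hx₀
        exact (Nat.cast_nonneg _).trans (hnz x₀ h1 h2)
      calc _ ≤ ∑ x ∈ T.filter fun x => ¬ φ x = 0, (M * D : ℝ) := by
            refine Finset.sum_le_sum fun x hx => ?_
            obtain ⟨h1, h2⟩ := Finset.mem_filter.mp hx
            exact hnz x h1 h2
        _ ≤ T.card * (M * D : ℝ) := by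
            rw [Finset.sum_const, nsmul_eq_mul]
            gcongr
            exact Finset.filter_subset _ _
        _ ≤ N * M ^ 2 * (M * D) := by gcongr
        _ = _ := by ring

/-- The bilinear trigonometric polynomial dominating `nearCount`. -/
def bilinearPoly (N M : ℕ) (θ : ℝ) : ℂ :=
  ∑ x ∈ Finset.Ico 1 N ×ˢ (Finset.range M ×ˢ Finset.range M),
    efun (((((x.2.1 : ℤ) - x.2.2) * x.1 : ℤ) : ℝ) * θ)

theorem bilinearPoly_eq (N M : ℕ) (θ : ℝ) :
    bilinearPoly N M θ =
      ((∑ r ∈ Finset.Ico 1 N, ‖∑ n ∈ Finset.range M, efun (n * (θ * r))‖ ^ 2 : ℝ) : ℂ) := by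
  rw [bilinearPoly, Finset.sum_product, Complex.ofReal_sum]
  refine Finset.sum_congr rfl fun r _ => ?_
  rw [sum_efun_mul_conj, Finset.sum_product]
  refine Finset.sum_congr rfl fun n _ => Finset.sum_congr rfl fun n' _ => ?_
  congr 1; push_cast; ring

theorem half_le_norm_sum_efun (M : ℕ) (α : ℝ) (h : M * |α - round α| ≤ 1 / 6) :
    (M / 2 : ℝ) ≤ ‖∑ n ∈ Finset.range M, efun (n * α)‖ := by
  refine le_trans ?_ (Complex.re_le_norm _)
  rw [Complex.re_sum]
  have : ∀ n ∈ Finset.range M, (1 / 2 : ℝ) ≤ (efun (n * α)).re := by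
    intro n hn
    have hn' : (n : ℝ) ≤ M := by exact_mod_cast (Finset.mem_range.mp hn).le
    set t := α - round α with ht
    have h1 : efun (n * α) = efun (n * t) := by
      have : (n : ℝ) * α = n * t + ((n * round α : ℤ) : ℝ) := by rw [ht]; push_cast; ring
      rw [this, efun_add, efun_int, mul_one]
    have h2 : (efun (n * t)).re = Real.cos (2 * Real.pi * (n * t)) := by
      rw [efun, show 2 * (Real.pi : ℂ) * Complex.I * ((n * t : ℝ) : ℂ) =
        ((2 * Real.pi * (n * t) : ℝ) : ℂ) * Complex.I by push_cast; ring,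
        Complex.exp_ofReal_mul_I_re]
    have h3 : |2 * Real.pi * (n * t)| ≤ Real.pi / 3 := by
      rw [abs_mul, abs_mul, abs_mul, abs_of_pos Real.pi_pos, abs_of_pos (by norm_num : (0 : ℝ) < 2),
        Nat.abs_cast]
      have : n * |t| ≤ 1 / 6 := (by gcongr : n * |t| ≤ M * |t|).trans h
      nlinarith [Real.pi_pos]
    rw [h1, h2, ← Real.cos_abs, ← Real.cos_pi_div_three]
    exact Real.cos_le_cos_of_nonneg_of_le_pi (abs_nonneg _) (by linarith [Real.pi_pos]) h3
  calc (M / 2 : ℝ) = ∑ n ∈ Finset.range M, (1 / 2 : ℝ) := by simp; ring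
    _ ≤ _ := Finset.sum_le_sum this

theorem nearCount_le_bilinearPoly (J j : ℕ) (θ : ℝ) :
    (nearCount J j θ : ℝ) ≤
      1 + 4 / ((2 : ℝ) ^ (j - 4)) ^ 2 * ‖bilinearPoly (2 ^ J) (2 ^ (j - 4)) θ‖ := by
  set M : ℕ := 2 ^ (j - 4) with hM
  have hM0 : (0 : ℝ) < M := by rw [hM]; positivity
  have hind : ∀ α : ℝ, |α - round α| ≤ 2 * (1 / 2 : ℝ) ^ j →
      1 ≤ 4 / (M : ℝ) ^ 2 * ‖∑ n ∈ Finset.range M, efun (n * α)‖ ^ 2 := by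
    intro α hα
    have hhalf : (M / 2 : ℝ) ≤ ‖∑ n ∈ Finset.range M, efun (n * α)‖ := by
      rcases le_or_gt j 4 with hj | hj
      · have : M = 1 := by rw [hM, Nat.sub_eq_zero_of_le hj, pow_zero]
        rw [this]
        simp [efun]
        norm_num
      · apply half_le_norm_sum_efun
        obtain ⟨k, rfl⟩ := Nat.exists_eq_add_of_le hj.le
        have h1 : (M : ℝ) = 2 ^ k := by rw [hM]; push_cast; congr 1; omega
        rw [h1]
        have h2 : (2 : ℝ) ^ k * (1 / 2) ^ k = 1 := by rw [← mul_pow]; norm_num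
        calc (2 : ℝ) ^ k * |α - round α| ≤ 2 ^ k * (2 * (1 / 2) ^ (4 + k)) := by gcongr
          _ = (2 ^ k * (1 / 2) ^ k) * (1 / 8) := by rw [pow_add]; ring
          _ ≤ _ := by rw [h2]; norm_num
    rw [div_mul_eq_mul_div, le_div_iff₀ (by positivity)]
    have := pow_le_pow_left₀ (by positivity) hhalf 2
    nlinarith
  have hnorm : ‖bilinearPoly (2 ^ J) M θ‖ =
      ∑ r ∈ Finset.Ico (1 : ℕ) (2 ^ J), ‖∑ n ∈ Finset.range M, efun (n * (θ * r))‖ ^ 2 := by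
    rw [bilinearPoly_eq, Complex.norm_of_nonneg (Finset.sum_nonneg fun _ _ => by positivity)]
  have hcast : ((2 : ℝ) ^ (j - 4)) = M := by rw [hM]; push_cast; rfl
  rw [hcast, hnorm, Finset.mul_sum, nearCount, Finset.card_filter]
  push_cast
  rw [Finset.range_eq_Ico, Finset.sum_eq_sum_Ico_succ_bot (Nat.two_pow_pos J)]
  refine add_le_add (by split_ifs <;> simp) ?_
  refine Finset.sum_le_sum fun r _ => ?_
  split_ifs with h
  · exact hind _ h
  · positivity

theorem sum_two_pow_succ_le (J : ℕ) :
    ∑ j ∈ Finset.range (J + 1), (2 : ℝ) ^ (j + 1) ≤ 4 * 2 ^ J := by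
  induction J with
  | zero => norm_num
  | succ k ih => rw [Finset.sum_range_succ]; rw [pow_succ 2 (k + 1), pow_succ 2 k] at *; linarith

theorem bilinearBound_nonneg (J : ℕ) (θ : ℝ) : 0 ≤ bilinearBound J θ :=
  Finset.sum_nonneg fun _ _ => by positivity

theorem nearCount_le (J j : ℕ) (θ : ℝ) : nearCount J j θ ≤ 2 ^ J :=
  (Finset.card_filter_le _ _).trans (Finset.card_range _).le

theorem bilinearBound_le_sq (J : ℕ) (θ : ℝ) : bilinearBound J θ ≤ 4 * ((2 : ℝ) ^ J) ^ 2 := by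
  calc bilinearBound J θ ≤ ∑ j ∈ Finset.range (J + 1), (2 : ℝ) ^ (j + 1) * 2 ^ J := by
        refine Finset.sum_le_sum fun j _ => ?_
        gcongr
        exact_mod_cast nearCount_le J j θ
    _ ≤ 4 * 2 ^ J * 2 ^ J := by
        rw [← Finset.sum_mul]; gcongr; exact sum_two_pow_succ_le J
    _ = _ := by ring

theorem abs_neg_sub_round_neg (x : ℝ) : |-x - round (-x)| = |x - round x| := by
  refine le_antisymm ?_ ?_
  · refine (round_le (-x) (-round x)).trans (le_of_eq ?_)
    rw [← abs_neg]; congr 1; push_cast; ring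
  · refine (round_le x (-round (-x))).trans (le_of_eq ?_)
    rw [← abs_neg]; congr 1; push_cast; ring

theorem bilinearBound_abs (J : ℕ) (θ : ℝ) : bilinearBound J |θ| = bilinearBound J θ := by
  rcases abs_cases θ with ⟨h, _⟩ | ⟨h, _⟩
  · rw [h]
  · rw [h]
    simp only [bilinearBound, nearCount, neg_mul, abs_neg_sub_round_neg]

theorem card_le_of_sub_le {F : Finset ℤ} {ℓ : ℝ} (hℓ : 0 ≤ ℓ)
    (h : ∀ a ∈ F, ∀ b ∈ F, (a - b : ℝ) ≤ ℓ) : (F.card : ℝ) ≤ ℓ + 1 := by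
  rcases F.eq_empty_or_nonempty with h0 | h0
  · simp [h0]; linarith
  · have h1 : F ⊆ Finset.Icc (F.min' h0) (F.max' h0) := fun a ha =>
      Finset.mem_Icc.mpr ⟨F.min'_le a ha, F.le_max' a ha⟩
    have h2 := Finset.card_le_card h1
    rw [Int.card_Icc] at h2
    have h3 := h _ (F.max'_mem h0) _ (F.min'_mem h0)
    have h4 : F.min' h0 ≤ F.max' h0 := F.min'_le _ (F.max'_mem h0)
    have h5 : (F.card : ℤ) ≤ F.max' h0 - F.min' h0 + 1 := by omega
    have h6 : (F.card : ℝ) ≤ F.max' h0 - F.min' h0 + 1 := by exact_mod_cast h5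
    linarith

theorem card_nat_le_of_sub_le {F : Finset ℕ} {ℓ : ℝ} (hℓ : 0 ≤ ℓ)
    (h : ∀ a ∈ F, ∀ b ∈ F, (a - b : ℝ) ≤ ℓ) : (F.card : ℝ) ≤ ℓ + 1 := by
  rw [← Finset.card_map Nat.castEmbedding (α := ℕ) (β := ℤ)]
  refine card_le_of_sub_le hℓ fun a ha b hb => ?_
  obtain ⟨a, ha', rfl⟩ := Finset.mem_map.mp ha
  obtain ⟨b, hb', rfl⟩ := Finset.mem_map.mp hb
  simpa using h a ha' b hb'

theorem abs_le_abs_sub_round {x : ℝ} (hx : |x| ≤ 1 / 2) : |x| ≤ |x - round x| := by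
  rcases eq_or_ne (round x) 0 with h | h
  · rw [h]; simp
  · have h1 : (1 : ℝ) ≤ |(round x : ℝ)| := by exact_mod_cast Int.one_le_abs h
    have h2 := abs_sub_abs_le_abs_sub (round x : ℝ) x
    rw [abs_sub_comm] at h2
    linarith

theorem sum_sqrt_two_pow_le (J : ℕ) :
    ∑ j ∈ Finset.range (J + 1), √2 ^ j ≤ 4 * √2 ^ J := by
  have h2 : (4 / 3 : ℝ) ≤ √2 := Real.le_sqrt_of_sq_le (by norm_num)
  induction J with
  | zero => norm_num
  | succ k ih =>
    rw [Finset.sum_range_succ, pow_succ]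
    have : 0 < √2 ^ k := by positivity
    nlinarith

theorem nearCount_le_of_small (J j : ℕ) {θ : ℝ} (hθ : 0 < θ) (hθJ : θ * 2 ^ J ≤ 1 / 2) :
    (nearCount J j θ : ℝ) ≤ 1 + √(2 ^ J * (2 * (1 / 2 : ℝ) ^ j / θ)) := by
  set δ : ℝ := 2 * (1 / 2 : ℝ) ^ j with hδ
  have hδ0 : 0 < δ := by positivity
  have h1 : (nearCount J j θ : ℝ) ≤ δ / θ + 1 := by
    refine card_nat_le_of_sub_le (by positivity) fun a ha b _ => ?_
    obtain ⟨ha1, ha2⟩ := Finset.mem_filter.mp ha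
    have haJ : (a : ℝ) ≤ 2 ^ J := by exact_mod_cast (Finset.mem_range.mp ha1).le
    have h3 : |θ * a| ≤ 1 / 2 := by
      rw [abs_of_nonneg (by positivity)]; exact (by gcongr : θ * a ≤ θ * 2 ^ J).trans hθJ
    have h4 := (abs_le_abs_sub_round h3).trans ha2
    rw [abs_of_nonneg (by positivity)] at h4
    have h5 : (a : ℝ) ≤ δ / θ := by rw [le_div_iff₀ hθ]; linarith
    have : (0 : ℝ) ≤ b := Nat.cast_nonneg b
    linarith
  have h2 : (nearCount J j θ : ℝ) ≤ 2 ^ J := by exact_mod_cast nearCount_le J j θ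
  rcases le_total (nearCount J j θ : ℝ) 1 with h3 | h3
  · have := Real.sqrt_nonneg (2 ^ J * (δ / θ)); linarith
  · have : (nearCount J j θ : ℝ) - 1 ≤ √(2 ^ J * (δ / θ)) := by
      apply Real.le_sqrt_of_sq_le
      rw [sq]
      exact mul_le_mul (by linarith) (by linarith) (by linarith) (by positivity)
    linarith

theorem bilinearBound_le_of_small (J : ℕ) {θ : ℝ} (hθ : 0 < θ) (hθJ : θ * 2 ^ J ≤ 1 / 2) :
    bilinearBound J θ ≤ 4 * 2 ^ J + 12 * (2 ^ J / √θ) := by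
  have hs : √8 * 4 ≤ 12 := by
    have : √8 ≤ 3 := Real.sqrt_le_iff.mpr (by norm_num)
    linarith
  calc bilinearBound J θ
      ≤ ∑ j ∈ Finset.range (J + 1), (2 : ℝ) ^ (j + 1) *
          (1 + √(2 ^ J * (2 * (1 / 2 : ℝ) ^ j / θ))) := by
        refine Finset.sum_le_sum fun j _ => ?_
        gcongr
        exact nearCount_le_of_small J j hθ hθJ
    _ = ∑ j ∈ Finset.range (J + 1), ((2 : ℝ) ^ (j + 1) + √8 * √(2 ^ J / θ) * √2 ^ j) := by
        refine Finset.sum_congr rfl fun j _ => ?_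
        rw [mul_add, mul_one]
        congr 1
        have h1 : ((2 : ℝ) ^ (j + 1)) = √((2 ^ (j + 1)) ^ 2) := (Real.sqrt_sq (by positivity)).symm
        have h2 : √2 ^ j = √(2 ^ j) := by
          refine (Real.sqrt_eq_iff_mul_self_eq (by positivity) (by positivity)).mpr ?_ |>.symm
          rw [← mul_pow, Real.mul_self_sqrt (by norm_num)]
        rw [h1, h2, ← Real.sqrt_mul (by positivity), ← Real.sqrt_mul (by positivity),
          ← Real.sqrt_mul (by positivity)]
        congr 1
        rw [pow_succ, one_div, inv_pow]
        field_simp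
        ring
    _ = ∑ j ∈ Finset.range (J + 1), (2 : ℝ) ^ (j + 1) +
          √8 * √(2 ^ J / θ) * ∑ j ∈ Finset.range (J + 1), √2 ^ j := by
        rw [Finset.sum_add_distrib, Finset.mul_sum]
    _ ≤ 4 * 2 ^ J + √8 * √(2 ^ J / θ) * (4 * √2 ^ J) := by
        gcongr
        · exact sum_two_pow_succ_le J
        · exact sum_sqrt_two_pow_le J
    _ = 4 * 2 ^ J + √8 * 4 * (2 ^ J / √θ) := by
        have h2 : √(2 ^ J) = √2 ^ J := by
          refine (Real.sqrt_eq_iff_mul_self_eq (by positivity) (by positivity)).mpr ?_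
          rw [← mul_pow, Real.mul_self_sqrt (by norm_num)]
        have h3 : √2 ^ J * √2 ^ J = 2 ^ J := by
          rw [← mul_pow, Real.mul_self_sqrt (by norm_num)]
        rw [Real.sqrt_div (by positivity), h2, ← h3]
        ring
    _ ≤ _ := by gcongr

theorem nearCount_le_of_large (J j : ℕ) {θ : ℝ} (hθ : 0 < θ) (hθJ : 1 / 2 ≤ θ * 2 ^ J) :
    (nearCount J j θ : ℝ) ≤ 5 * (θ * 2 ^ J) * (4 * (1 / 2 : ℝ) ^ j / θ + 1) := by
  classical
  set δ : ℝ := 2 * (1 / 2 : ℝ) ^ j with hδ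
  have hδ0 : 0 < δ := by positivity
  set F := (Finset.range (2 ^ J)).filter (fun r : ℕ => |θ * r - round (θ * r)| ≤ δ) with hF
  have himg : ((F.image fun r : ℕ => round (θ * r)).card : ℝ) ≤ θ * 2 ^ J + 1 + 1 := by
    refine card_le_of_sub_le (by positivity) fun a ha b hb => ?_
    obtain ⟨r, hr, rfl⟩ := Finset.mem_image.mp ha
    obtain ⟨r', hr', rfl⟩ := Finset.mem_image.mp hb
    have h1 := abs_le.mp (abs_sub_round (θ * r))
    have h2 := abs_le.mp (abs_sub_round (θ * r'))
    have h3 : (r : ℝ) ≤ 2 ^ J := by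
      exact_mod_cast (Finset.mem_range.mp (Finset.mem_filter.mp hr).1).le
    have h4 : θ * r ≤ θ * 2 ^ J := by gcongr
    have h5 : 0 ≤ θ * r' := by positivity
    linarith
  have hfib : ∀ k ∈ F.image fun r : ℕ => round (θ * r),
      ((F.filter fun r : ℕ => round (θ * r) = k).card : ℝ) ≤ 4 * (1 / 2 : ℝ) ^ j / θ + 1 := by
    intro k _
    refine card_nat_le_of_sub_le (by positivity) fun a ha b hb => ?_
    obtain ⟨ha1, ha2⟩ := Finset.mem_filter.mp ha
    obtain ⟨hb1, hb2⟩ := Finset.mem_filter.mp hb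
    have h1 := abs_le.mp (Finset.mem_filter.mp ha1).2
    have h2 := abs_le.mp (Finset.mem_filter.mp hb1).2
    rw [ha2] at h1
    rw [hb2] at h2
    rw [le_div_iff₀ hθ]
    linarith
  have hcard : (F.card : ℝ) =
      ∑ k ∈ F.image fun r : ℕ => round (θ * r),
        ((F.filter fun r : ℕ => round (θ * r) = k).card : ℝ) := by
    exact_mod_cast Finset.card_eq_sum_card_image (fun r : ℕ => round (θ * r)) F
  calc (nearCount J j θ : ℝ) = F.card := rfl
    _ ≤ ∑ k ∈ F.image fun r : ℕ => round (θ * r), (4 * (1 / 2 : ℝ) ^ j / θ + 1) := by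
        rw [hcard]; exact Finset.sum_le_sum hfib
    _ = (F.image fun r : ℕ => round (θ * r)).card * (4 * (1 / 2 : ℝ) ^ j / θ + 1) := by
        rw [Finset.sum_const, nsmul_eq_mul]
    _ ≤ _ := by gcongr; linarith

theorem bilinearBound_le_of_large (J : ℕ) {θ : ℝ} (hθ : 0 < θ) (hθJ : 1 / 2 ≤ θ * 2 ^ J) :
    bilinearBound J θ ≤ 40 * (J + 1) * 2 ^ J + 20 * θ * (2 ^ J) ^ 2 := by
  calc bilinearBound J θ
      ≤ ∑ j ∈ Finset.range (J + 1), (2 : ℝ) ^ (j + 1) *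
          (5 * (θ * 2 ^ J) * (4 * (1 / 2 : ℝ) ^ j / θ + 1)) := by
        refine Finset.sum_le_sum fun j _ => ?_
        gcongr
        exact nearCount_le_of_large J j hθ hθJ
    _ = ∑ j ∈ Finset.range (J + 1), (40 * (2 : ℝ) ^ J + 5 * (θ * 2 ^ J) * 2 ^ (j + 1)) := by
        refine Finset.sum_congr rfl fun j _ => ?_
        rw [pow_succ, one_div, inv_pow]
        field_simp
        ring
    _ = 40 * (J + 1) * 2 ^ J + 5 * (θ * 2 ^ J) * ∑ j ∈ Finset.range (J + 1), (2 : ℝ) ^ (j + 1) := by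
        rw [Finset.sum_add_distrib, Finset.sum_const, Finset.card_range, nsmul_eq_mul,
          ← Finset.mul_sum]
        push_cast; ring
    _ ≤ 40 * (J + 1) * 2 ^ J + 5 * (θ * 2 ^ J) * (4 * 2 ^ J) := by
        gcongr; exact sum_two_pow_succ_le J
    _ = _ := by ring

theorem integral_norm_bilinearPoly_sq_le (N M : ℕ) (D : ℝ)
    (hD : ∀ n : ℕ, n ≠ 0 → n ≤ N * M → (n.divisors.card : ℝ) ≤ D) :
    ∫ θ in (-1 : ℝ)..1, ‖bilinearPoly N M θ‖ ^ 2 ≤ 2 * ((N * M : ℝ) ^ 2 + N * M ^ 3 * D) := by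
  unfold bilinearPoly
  rw [integral_norm_sum_efun_sq]
  gcongr
  exact sum_card_bilinear_fiber_le N M D hD

theorem exists_sq_majorant (J : ℕ) (D : ℝ) (hD1 : 1 ≤ D)
    (hD : ∀ n : ℕ, n ≠ 0 → n ≤ 2 ^ J * 2 ^ J → (n.divisors.card : ℝ) ≤ D) :
    ∃ R : ℝ → ℝ, Continuous R ∧ (∀ θ, bilinearBound J θ ^ 2 ≤ R θ) ∧
      ∫ θ in (-1 : ℝ)..1, R θ ≤ 2 ^ 18 * (J + 1) ^ 2 * D * (2 ^ J) ^ 2 := by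
  set Q : ℕ → ℝ → ℝ := fun j θ => ‖bilinearPoly (2 ^ J) (2 ^ (j - 4)) θ‖ with hQ
  have hQc : ∀ j, Continuous (Q j) := fun j => by
    refine Continuous.norm (continuous_finsetSum _ fun x _ => continuous_efun.comp ?_)
    fun_prop
  refine ⟨fun θ => (J + 1) * ∑ j ∈ Finset.range (J + 1), (4 : ℝ) ^ (j + 1) *
    (2 + 32 / ((2 : ℝ) ^ (j - 4)) ^ 4 * Q j θ ^ 2), ?_, ?_, ?_⟩
  · have := hQc
    fun_prop
  · intro θ
    calc bilinearBound J θ ^ 2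
        ≤ (Finset.range (J + 1)).card * ∑ j ∈ Finset.range (J + 1),
            ((2 : ℝ) ^ (j + 1) * nearCount J j θ) ^ 2 := sq_sum_le_card_mul_sum_sq
      _ ≤ _ := by
          rw [Finset.card_range]
          push_cast
          gcongr with j _
          rw [mul_pow, ← pow_mul, mul_comm (j + 1), pow_mul]
          norm_num only
          gcongr
          have h1 := nearCount_le_bilinearPoly J j θ
          have h2 : (nearCount J j θ : ℝ) ^ 2 ≤ (1 + 4 / ((2 : ℝ) ^ (j - 4)) ^ 2 * Q j θ) ^ 2 := by
            gcongr
          have h3 : 32 / ((2 : ℝ) ^ (j - 4)) ^ 4 * Q j θ ^ 2 =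
              2 * (4 / ((2 : ℝ) ^ (j - 4)) ^ 2 * Q j θ) ^ 2 := by ring
          rw [h3]
          nlinarith [sq_nonneg (1 - 4 / ((2 : ℝ) ^ (j - 4)) ^ 2 * Q j θ)]
  · rw [intervalIntegral.integral_const_mul, intervalIntegral.integral_finsetSum fun j _ => by
      apply Continuous.intervalIntegrable
      have := hQc
      fun_prop]
    have hterm : ∀ j ∈ Finset.range (J + 1), ∫ θ in (-1 : ℝ)..1, (4 : ℝ) ^ (j + 1) *
        (2 + 32 / ((2 : ℝ) ^ (j - 4)) ^ 4 * Q j θ ^ 2) ≤ 2 ^ 18 * D * (2 ^ J) ^ 2 := by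
      intro j hj
      have hjJ : j ≤ J := by simpa [Nat.lt_succ_iff] using hj
      rw [intervalIntegral.integral_const_mul, intervalIntegral.integral_add
        (by simp) (by apply Continuous.intervalIntegrable; have := hQc; fun_prop),
        intervalIntegral.integral_const_mul]
      have hMN : (2 : ℕ) ^ (j - 4) ≤ 2 ^ J := Nat.pow_le_pow_right (by norm_num) (by omega)
      have h1 := integral_norm_bilinearPoly_sq_le (2 ^ J) (2 ^ (j - 4)) D fun n hn hn' =>
        hD n hn (hn'.trans (Nat.mul_le_mul_left _ hMN))
      push_cast at h1
      have hMN' : (2 : ℝ) ^ (j - 4) ≤ 2 ^ J := by exact_mod_cast hMN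
      have hMj : (4 : ℝ) ^ (j + 1) ≤ 1024 * ((2 : ℝ) ^ (j - 4)) ^ 2 := by
        rw [show (1024 : ℝ) = 4 ^ 5 by norm_num, ← pow_mul, mul_comm (j - 4), pow_mul]
        norm_num only
        rw [show (1024 : ℝ) = 4 ^ 5 by norm_num, ← pow_add]
        exact pow_le_pow_right₀ (by norm_num) (by omega)
      set M : ℝ := (2 : ℝ) ^ (j - 4)
      set N : ℝ := (2 : ℝ) ^ J
      have hM : 1 ≤ M := one_le_pow₀ (by norm_num)
      have hN : 0 < N := by positivity
      set I := ∫ θ in (-1 : ℝ)..1, Q j θ ^ 2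
      have h2 : M ^ 2 * (32 / M ^ 4 * I) ≤ 64 * N ^ 2 + 64 * N ^ 2 * D := by
        calc M ^ 2 * (32 / M ^ 4 * I)
            ≤ M ^ 2 * (32 / M ^ 4 * (2 * ((N * M) ^ 2 + N * M ^ 3 * D))) := by
              gcongr
          _ = 64 * N ^ 2 + 64 * (N * M) * D := by field_simp; ring
          _ ≤ 64 * N ^ 2 + 64 * (N * N) * D := by gcongr
          _ = _ := by ring
      have hI : 0 ≤ 32 / M ^ 4 * I := by
        have : 0 ≤ I := intervalIntegral.integral_nonneg (by norm_num) fun _ _ => by positivity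
        positivity
      have h3 : ∫ _ in (-1 : ℝ)..1, (2 : ℝ) = 4 := by simp; norm_num
      rw [h3]
      calc (4 : ℝ) ^ (j + 1) * (4 + 32 / M ^ 4 * I)
          ≤ 1024 * M ^ 2 * (4 + 32 / M ^ 4 * I) := by gcongr
        _ = 1024 * (4 * M ^ 2 + M ^ 2 * (32 / M ^ 4 * I)) := by ring
        _ ≤ 1024 * (4 * N ^ 2 + (64 * N ^ 2 + 64 * N ^ 2 * D)) := by gcongr
        _ ≤ 2 ^ 18 * D * N ^ 2 := by nlinarith [sq_nonneg N]
    calc _ ≤ (J + 1 : ℝ) * ∑ j ∈ Finset.range (J + 1), (2 ^ 18 * D * (2 ^ J) ^ 2) := by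
          gcongr with j hj
          exact hterm j hj
      _ = _ := by
          rw [Finset.sum_const, Finset.card_range, nsmul_eq_mul]; push_cast; ring

theorem bilinearBound_mul_sqrt_le {J : ℕ} {L s : ℝ} (hL : 1 ≤ L) (hs : |s| * 2 ^ J ≤ L ^ 2 / 2) :
    bilinearBound J (s / L ^ 2) * √(1 + |s|) ≤ 32 * (2 ^ J * (2 ^ J + L)) := by
  have hN : (1 : ℝ) ≤ 2 ^ J := one_le_pow₀ (by norm_num)
  set N : ℝ := 2 ^ J with hNdef
  rcases le_total |s| 1 with h1 | h1
  · have hw : √(1 + |s|) ≤ 2 := Real.sqrt_le_iff.mpr ⟨by norm_num, by linarith⟩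
    calc bilinearBound J (s / L ^ 2) * √(1 + |s|) ≤ (4 * N ^ 2) * 2 :=
          mul_le_mul (bilinearBound_le_sq J _) hw (Real.sqrt_nonneg _) (by positivity)
      _ ≤ _ := by nlinarith
  · have hs0 : 0 < |s| := by linarith
    have hw : √(1 + |s|) ≤ 2 * √|s| := by
      rw [Real.sqrt_le_left (by positivity), mul_pow, Real.sq_sqrt hs0.le]
      linarith
    have hsL : √|s| ≤ L := by
      rw [Real.sqrt_le_left (by linarith)]
      nlinarith
    have hsq : 0 < √|s| := Real.sqrt_pos.mpr hs0
    have hP : bilinearBound J (s / L ^ 2) ≤ 4 * N + 12 * (N * L / √|s|) := by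
      rw [← bilinearBound_abs, abs_div, abs_of_pos (by positivity : 0 < L ^ 2)]
      refine (bilinearBound_le_of_small J (by positivity) ?_).trans (le_of_eq ?_)
      · rw [div_mul_eq_mul_div, div_le_iff₀ (by positivity)]; linarith
      · rw [Real.sqrt_div (abs_nonneg s), Real.sqrt_sq (by linarith)]
        congr 2
        field_simp
        exact hNdef.symm
    calc bilinearBound J (s / L ^ 2) * √(1 + |s|) ≤ (4 * N + 12 * (N * L / √|s|)) * (2 * √|s|) :=
          mul_le_mul hP hw (Real.sqrt_nonneg _) (by positivity)
      _ = 8 * N * √|s| + 24 * (N * L) := by field_simp; ring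
      _ ≤ 8 * N * L + 24 * (N * L) := by gcongr
      _ ≤ _ := by nlinarith

theorem lintegral_cube_small_le {J : ℕ} {L : ℝ} (hL : 1 ≤ L) :
    ∫⁻ s in {s : ℝ | |s| * 2 ^ J ≤ L ^ 2 / 2}, ENNReal.ofReal (bilinearBound J (s / L ^ 2) ^ 3) ≤
      ENNReal.ofReal ((32 * (2 ^ J * (2 ^ J + L))) ^ 3 * ∫ s : ℝ, (1 + ‖s‖) ^ (-(3 / 2) : ℝ)) := by
  have hint : Integrable fun s : ℝ => (1 + ‖s‖) ^ (-(3 / 2) : ℝ) :=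
    integrable_one_add_norm (by norm_num)
  set K : ℝ := 32 * (2 ^ J * (2 ^ J + L)) with hK
  have hK0 : 0 ≤ K := by positivity
  rw [← integral_const_mul, ofReal_integral_eq_lintegral_ofReal (hint.const_mul _)
    (Filter.Eventually.of_forall fun s => by positivity)]
  refine (setLIntegral_mono' (measurableSet_le (by fun_prop) (by fun_prop)) fun s hs => ?_).trans
    (setLIntegral_le_lintegral _ _)
  apply ENNReal.ofReal_le_ofReal
  have h1 := bilinearBound_mul_sqrt_le hL hs
  have hw : 0 < √(1 + |s|) := Real.sqrt_pos.mpr (by positivity)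
  have h2 : (1 + ‖s‖) ^ (-(3 / 2) : ℝ) = (√(1 + |s|) ^ 3)⁻¹ := by
    rw [Real.rpow_neg (by positivity), Real.norm_eq_abs, Real.sqrt_eq_rpow, ← Real.rpow_natCast,
      ← Real.rpow_mul (by positivity)]
    norm_num
  rw [h2, ← div_eq_mul_inv, le_div_iff₀ (by positivity), ← mul_pow]
  gcongr
  exact mul_nonneg (bilinearBound_nonneg _ _) hw.le

theorem lintegral_cube_large_le {J : ℕ} {L U D : ℝ} (hL : 1 ≤ L) (hU : U ≤ L ^ 2) (hD1 : 1 ≤ D)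
    (hD : ∀ n : ℕ, n ≠ 0 → n ≤ 2 ^ J * 2 ^ J → (n.divisors.card : ℝ) ≤ D) :
    ∫⁻ s in {s : ℝ | |s| < U ∧ L ^ 2 / 2 < |s| * 2 ^ J},
        ENNReal.ofReal (bilinearBound J (s / L ^ 2) ^ 3) ≤
      ENNReal.ofReal ((40 * (J + 1) * 2 ^ J + 20 * (U / L ^ 2) * (2 ^ J) ^ 2) *
        (L ^ 2 * (2 ^ 18 * (J + 1) ^ 2 * D * (2 ^ J) ^ 2))) := by
  obtain ⟨R, hRc, hPR, hRint⟩ := exists_sq_majorant J D hD1 hD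
  have hL2 : 0 < L ^ 2 := by positivity
  rcases lt_or_ge U 0 with hU0 | hU0
  · have : {s : ℝ | |s| < U ∧ L ^ 2 / 2 < |s| * 2 ^ J} = ∅ := by
      ext s; simp only [Set.mem_ofPred_eq, Set.mem_empty_iff_false, iff_false]
      intro h; linarith [abs_nonneg s, h.1]
    simp [this]
  set K : ℝ := 40 * (J + 1) * 2 ^ J + 20 * (U / L ^ 2) * (2 ^ J) ^ 2 with hK
  have hK0 : 0 ≤ K := by positivity
  have hR0 : ∀ θ, 0 ≤ R θ := fun θ => (sq_nonneg _).trans (hPR θ)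
  have hcont : Continuous fun s : ℝ => K * R (s / L ^ 2) := by fun_prop
  calc _ ≤ ∫⁻ s in {s : ℝ | |s| < U ∧ L ^ 2 / 2 < |s| * 2 ^ J},
            ENNReal.ofReal (K * R (s / L ^ 2)) := by
        refine setLIntegral_mono' ?_ fun s hs => ENNReal.ofReal_le_ofReal ?_
        · have m1 : MeasurableSet {s : ℝ | |s| < U} := measurableSet_lt (by fun_prop) (by fun_prop)
          have m2 : MeasurableSet {s : ℝ | L ^ 2 / 2 < |s| * 2 ^ J} :=
            measurableSet_lt (by fun_prop) (by fun_prop)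
          exact m1.inter m2
        · have hs0 : 0 < |s| := by
            by_contra! h
            have h1 : |s| = 0 := le_antisymm h (abs_nonneg s)
            have := hs.2
            rw [h1] at this; linarith
          have hPK : bilinearBound J (s / L ^ 2) ≤ K := by
            rw [← bilinearBound_abs, abs_div, abs_of_pos hL2]
            refine (bilinearBound_le_of_large J (by positivity) ?_).trans ?_
            · rw [div_mul_eq_mul_div, le_div_iff₀ hL2]; linarith [hs.2]
            · rw [hK]; gcongr; exact hs.1.le
          calc bilinearBound J (s / L ^ 2) ^ 3
              = bilinearBound J (s / L ^ 2) * bilinearBound J (s / L ^ 2) ^ 2 := by ring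
            _ ≤ _ := mul_le_mul hPK (hPR _) (sq_nonneg _) hK0
    _ ≤ ∫⁻ s in Set.Ioc (-L ^ 2) (L ^ 2), ENNReal.ofReal (K * R (s / L ^ 2)) := by
        refine lintegral_mono_set fun s hs => ?_
        have := abs_lt.mp (hs.1.trans_le hU)
        exact ⟨by linarith, this.2.le⟩
    _ = ENNReal.ofReal (∫ s in (-L ^ 2)..(L ^ 2), K * R (s / L ^ 2)) := by
        rw [intervalIntegral.integral_of_le (by linarith), ofReal_integral_eq_lintegral_ofReal]
        · exact (hcont.integrableOn_Icc).mono_set Set.Ioc_subset_Icc_self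
        · exact Filter.Eventually.of_forall fun s => mul_nonneg hK0 (hR0 _)
    _ ≤ _ := by
        apply ENNReal.ofReal_le_ofReal
        rw [intervalIntegral.integral_const_mul, intervalIntegral.integral_comp_div R hL2.ne',
          neg_div, div_self hL2.ne', smul_eq_mul]
        gcongr

/-- The third moment bound for the bilinear sums. -/
theorem exists_lintegral_bilinearBound_cube_le {γ : ℝ} (hγ : γ < 1) {c : ℝ} (hc : 1 ≤ c) :
    ∃ C : ℝ, 0 < C ∧ ∀ (L lam : ℝ) (J : ℕ), 1 ≤ L → 1 ≤ lam → (2 : ℝ) ^ J ≤ c * (lam * L) →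
      ∫⁻ s in {s : ℝ | |s| < L ^ (2 * γ)}, ENNReal.ofReal (bilinearBound J (s / L ^ 2) ^ 3) ≤
        ENNReal.ofReal (C * (lam * L) ^ 6) := by
  set δ : ℝ := min 1 (2 - 2 * γ) with hδ
  have hδ0 : 0 < δ := lt_min one_pos (by linarith)
  obtain ⟨B, hB1, hB⟩ := exists_card_divisors_le_rpow (ε := δ / 5) (by positivity)
  set I₀ := ∫ s : ℝ, (1 + ‖s‖) ^ (-(3 / 2) : ℝ) with hI₀
  have hI₀0 : 0 ≤ I₀ := integral_nonneg fun s => by positivity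
  have hc0 : 0 < c := by linarith
  have hB0 : 0 < B := by linarith
  refine ⟨(64 * c ^ 2) ^ 3 * I₀ + 60 * 2 ^ 18 * B ^ 4 * c ^ 5, by positivity,
    fun L lam J hL hlam hN => ?_⟩
  have hL0 : 0 < L := by linarith
  have hlam0 : 0 < lam := by linarith
  have hLL : L ≤ lam * L := le_mul_of_one_le_left hL0.le hlam
  have hN1 : (1 : ℝ) ≤ 2 ^ J := one_le_pow₀ (by norm_num)
  set U : ℝ := L ^ (2 * γ) with hU
  have hU0 : 0 < U := by positivity
  have hU2 : U ≤ L ^ 2 := by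
    rw [← Real.rpow_natCast L 2]
    exact Real.rpow_le_rpow_of_exponent_le hL (by push_cast; linarith)
  set y : ℝ := ((2 : ℝ) ^ J) ^ (δ / 5) with hy
  have hy1 : 1 ≤ y := Real.one_le_rpow hN1 (by positivity)
  have hJ : (J + 1 : ℝ) ≤ B * y := by
    have := hB (2 ^ J) (by positivity)
    rw [Nat.divisors_prime_pow Nat.prime_two, Finset.card_map, Finset.card_range] at this
    push_cast at this
    exact this
  have hD : ∀ n : ℕ, n ≠ 0 → n ≤ 2 ^ J * 2 ^ J → (n.divisors.card : ℝ) ≤ B * y ^ 2 := by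
    intro n hn hn'
    refine (hB n hn).trans ?_
    have h1 : (n : ℝ) ≤ (2 : ℝ) ^ J * 2 ^ J := by exact_mod_cast hn'
    have h2 : (n : ℝ) ^ (δ / 5) ≤ y ^ 2 := by
      calc (n : ℝ) ^ (δ / 5) ≤ ((2 : ℝ) ^ J * 2 ^ J) ^ (δ / 5) := by gcongr
        _ = y ^ 2 := by rw [Real.mul_rpow (by positivity) (by positivity), sq]
    gcongr
  have hy5 : y ^ 5 = ((2 : ℝ) ^ J) ^ δ := by
    rw [hy, ← Real.rpow_natCast, ← Real.rpow_mul (by positivity)]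
    congr 1; push_cast; ring
  have hy5N : y ^ 5 ≤ 2 ^ J := by
    rw [hy5]
    exact Real.rpow_le_self_of_one_le hN1 (min_le_left _ _)
  have hy5L : U * y ^ 5 ≤ c * lam * L ^ 2 := by
    have h1 : ((2 : ℝ) ^ J) ^ δ ≤ c * lam * L ^ δ := by
      calc ((2 : ℝ) ^ J) ^ δ ≤ (c * (lam * L)) ^ δ := by gcongr
        _ = (c * lam) ^ δ * L ^ δ := by
            rw [← mul_assoc, Real.mul_rpow (by positivity) (by positivity)]
        _ ≤ _ := by
            gcongr
            exact Real.rpow_le_self_of_one_le (one_le_mul_of_one_le_of_one_le hc hlam)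
              (min_le_left _ _)
    have h2 : U * L ^ δ ≤ L ^ 2 := by
      rw [hU, ← Real.rpow_add hL0, ← Real.rpow_natCast L 2]
      refine Real.rpow_le_rpow_of_exponent_le hL ?_
      have := min_le_right 1 (2 - 2 * γ)
      push_cast; linarith
    rw [hy5]
    calc U * ((2 : ℝ) ^ J) ^ δ ≤ U * (c * lam * L ^ δ) := by gcongr
      _ = c * lam * (U * L ^ δ) := by ring
      _ ≤ _ := by gcongr
  have hsub : {s : ℝ | |s| < U} ⊆ {s : ℝ | |s| * 2 ^ J ≤ L ^ 2 / 2} ∪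
      {s : ℝ | |s| < U ∧ L ^ 2 / 2 < |s| * 2 ^ J} := by
    intro s hs
    rcases le_or_gt (|s| * 2 ^ J) (L ^ 2 / 2) with h | h
    · exact Or.inl h
    · exact Or.inr ⟨hs, h⟩
  refine (lintegral_mono_set hsub).trans ((lintegral_union_le _ _ _).trans ?_)
  refine (add_le_add (lintegral_cube_small_le hL)
    (lintegral_cube_large_le hL hU2 (one_le_mul_of_one_le_of_one_le hB1 (one_le_pow₀ hy1))
      hD)).trans ?_
  rw [← ENNReal.ofReal_add (by positivity) (by positivity)]
  apply ENNReal.ofReal_le_ofReal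
  rw [add_mul ((64 * c ^ 2) ^ 3 * I₀)]
  set N : ℝ := 2 ^ J with hNdef
  have hN0 : 0 < N := by positivity
  refine add_le_add ?_ ?_
  · have h1 : 32 * (N * (N + L)) ≤ 64 * c ^ 2 * (lam * L) ^ 2 := by
      have h2 : N + L ≤ 2 * (c * (lam * L)) := by nlinarith
      calc 32 * (N * (N + L)) ≤ 32 * (c * (lam * L) * (2 * (c * (lam * L)))) := by gcongr
        _ = _ := by ring
    calc (32 * (N * (N + L))) ^ 3 * I₀ ≤ (64 * c ^ 2 * (lam * L) ^ 2) ^ 3 * I₀ := by gcongr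
      _ = _ := by ring
  · have hJ0 : (0 : ℝ) ≤ J + 1 := by positivity
    calc (40 * (J + 1) * N + 20 * (U / L ^ 2) * N ^ 2) *
          (L ^ 2 * (2 ^ 18 * (J + 1) ^ 2 * (B * y ^ 2) * N ^ 2))
        = 2 ^ 18 * (40 * ((J + 1) ^ 3 * (B * y ^ 2)) * N ^ 3 * L ^ 2 +
            20 * U * ((J + 1) ^ 2 * (B * y ^ 2)) * N ^ 4) := by
          field_simp
      _ ≤ 2 ^ 18 * (40 * ((B * y) ^ 3 * (B * y ^ 2)) * N ^ 3 * L ^ 2 +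
            20 * U * ((B * y) ^ 3 * (B * y ^ 2)) * N ^ 4) := by
          have h1 : (J + 1 : ℝ) ^ 3 ≤ (B * y) ^ 3 := by gcongr
          have h2 : (J + 1 : ℝ) ^ 2 ≤ (B * y) ^ 3 := by
            calc (J + 1 : ℝ) ^ 2 ≤ (B * y) ^ 2 := by gcongr
              _ ≤ (B * y) ^ 3 := pow_le_pow_right₀
                (one_le_mul_of_one_le_of_one_le hB1 hy1) (by norm_num)
          gcongr
      _ = 2 ^ 18 * B ^ 4 * (40 * y ^ 5 * N ^ 3 * L ^ 2 + 20 * (U * y ^ 5) * N ^ 4) := by ring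
      _ ≤ 2 ^ 18 * B ^ 4 * (40 * N * N ^ 3 * L ^ 2 + 20 * (c * lam * L ^ 2) * N ^ 4) := by gcongr
      _ = 2 ^ 18 * B ^ 4 * (N ^ 4 * L ^ 2 * (40 + 20 * (c * lam))) := by ring
      _ ≤ 2 ^ 18 * B ^ 4 * ((c * (lam * L)) ^ 4 * L ^ 2 * (60 * (c * lam ^ 2))) := by
          have h3 : 1 ≤ c * lam := one_le_mul_of_one_le_of_one_le hc hlam
          have h4 : c * lam ≤ c * lam ^ 2 := by gcongr; nlinarith
          gcongr
          linarith
      _ = _ := by ring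

section SummationByParts

variable {M : Type*} [AddCommGroup M]

/-- The difference `F k - F (k + v)`. -/
def fdiff (v : M) (F : M → ℂ) : M → ℂ := fun k => F k - F (k + v)

/-- The difference `F k - F (k - v)`. -/
def bdiff (v : M) (F : M → ℂ) : M → ℂ := fun k => F k - F (k - v)

/-- Iterated differences `fdiff` along a list of directions. -/
def fdiffList : List M → (M → ℂ) → M → ℂ
  | [], F => F
  | v :: l, F => fdiffList l (fdiff v F)

/-- Iterated differences `bdiff` along a list of directions. -/
def bdiffList (l : List M) (F : M → ℂ) : M → ℂ := l.foldr bdiff F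

theorem support_fdiff_finite {F : M → ℂ} (hF : F.support.Finite) (v : M) :
    (fdiff v F).support.Finite := by
  refine (hF.union (hF.preimage (add_left_injective v).injOn)).subset fun k hk => ?_
  by_contra! h
  simp only [Set.mem_union, Set.mem_preimage, Function.mem_support, not_or, not_not] at h
  exact hk (by simp [fdiff, h.1, h.2])

theorem tsum_mul_bdiff {F : M → ℂ} (hF : F.support.Finite) (v : M) (S : M → ℂ) :
    ∑' k, F k * bdiff v S k = ∑' k, fdiff v F k * S k := by
  have key : ∀ (F' S' : M → ℂ), F'.support.Finite → Summable fun k => F' k * S' k :=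
    fun F' S' h => summable_of_hasFiniteSupport (h.subset fun k hk => left_ne_zero_of_mul hk)
  have hF' : (fun k => F (k + v)).support.Finite :=
    hF.preimage (add_left_injective v).injOn
  have h1 : ∑' k, F k * S (k - v) = ∑' k, F (k + v) * S k := by
    rw [← (Equiv.addRight v).tsum_eq]
    simp
  simp only [bdiff, fdiff, mul_sub, sub_mul]
  rw [(key F S hF).tsum_sub (key F (fun k => S (k - v)) hF), h1,
    (key F S hF).tsum_sub (key _ S hF')]

theorem tsum_mul_bdiffList (l : List M) {F : M → ℂ} (hF : F.support.Finite) (S : M → ℂ) :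
    ∑' k, F k * bdiffList l S k = ∑' k, fdiffList l F k * S k := by
  induction l generalizing F with
  | nil => rfl
  | cons v l ih =>
    exact (tsum_mul_bdiff hF v _).trans (ih (support_fdiff_finite hF v))

theorem fdiffList_eq_zero {l : List M} {F : M → ℂ} {U : Set M} (hU : ∀ v ∈ l, ∀ k ∈ U, k + v ∈ U)
    (hF : ∀ k ∈ U, F k = 0) : ∀ k ∈ U, fdiffList l F k = 0 := by
  induction l generalizing F with
  | nil => exact hF
  | cons v l ih =>
    refine ih (fun w hw => hU w (List.mem_cons_of_mem _ hw)) fun k hk => ?_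
    simp [fdiff, hF k hk, hF _ (hU v List.mem_cons_self k hk)]

end SummationByParts

section Box

variable {ι : Type*} [Fintype ι] [DecidableEq ι]

theorem bdiffList_single_inl (f : ι → ℤ → ℤ → ℂ) {l : List ι} (hl : l.Nodup) :
    bdiffList (l.map fun i => ((Pi.single i 1, 0) : (ι → ℤ) × (ι → ℤ)))
      (fun k => ∏ i, f i (k.1 i) (k.2 i)) =
    fun k => ∏ i, if i ∈ l then f i (k.1 i) (k.2 i) - f i (k.1 i - 1) (k.2 i)
      else f i (k.1 i) (k.2 i) := by
  induction l with
  | nil => simp [bdiffList]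
  | cons j l ih =>
    obtain ⟨hj, hl⟩ := List.nodup_cons.mp hl
    have h := ih hl
    simp only [bdiffList, List.map_cons, List.foldr_cons] at h ⊢
    rw [h]
    funext k
    simp only [bdiff]
    rw [← Finset.mul_prod_erase _ _ (Finset.mem_univ j),
      ← Finset.mul_prod_erase _ _ (Finset.mem_univ j),
      ← Finset.mul_prod_erase _ _ (Finset.mem_univ j)]
    have e1 : ∏ i ∈ Finset.univ.erase j, (if i ∈ l then
        f i ((k - (Pi.single j 1, 0)).1 i) ((k - (Pi.single j 1, 0)).2 i) -
          f i ((k - (Pi.single j 1, 0)).1 i - 1) ((k - (Pi.single j 1, 0)).2 i)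
        else f i ((k - (Pi.single j 1, 0)).1 i) ((k - (Pi.single j 1, 0)).2 i)) =
        ∏ i ∈ Finset.univ.erase j, if i ∈ l then f i (k.1 i) (k.2 i) - f i (k.1 i - 1) (k.2 i)
      else f i (k.1 i) (k.2 i) := by
      refine Finset.prod_congr rfl fun i hi => ?_
      simp [Finset.ne_of_mem_erase hi]
    have e2 : ∏ i ∈ Finset.univ.erase j, (if i ∈ j :: l then
        f i (k.1 i) (k.2 i) - f i (k.1 i - 1) (k.2 i) else f i (k.1 i) (k.2 i)) =
        ∏ i ∈ Finset.univ.erase j, if i ∈ l then f i (k.1 i) (k.2 i) - f i (k.1 i - 1) (k.2 i)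
      else f i (k.1 i) (k.2 i) := by
      refine Finset.prod_congr rfl fun i hi => ?_
      simp [Finset.ne_of_mem_erase hi]
    rw [e1, e2, ← sub_mul]
    simp [hj]

theorem bdiffList_single_inr (f : ι → ℤ → ℤ → ℂ) {l : List ι} (hl : l.Nodup) :
    bdiffList (l.map fun i => ((0, Pi.single i 1) : (ι → ℤ) × (ι → ℤ)))
      (fun k => ∏ i, f i (k.1 i) (k.2 i)) =
    fun k => ∏ i, if i ∈ l then f i (k.1 i) (k.2 i) - f i (k.1 i) (k.2 i - 1)
      else f i (k.1 i) (k.2 i) := by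
  induction l with
  | nil => simp [bdiffList]
  | cons j l ih =>
    obtain ⟨hj, hl⟩ := List.nodup_cons.mp hl
    have h := ih hl
    simp only [bdiffList, List.map_cons, List.foldr_cons] at h ⊢
    rw [h]
    funext k
    simp only [bdiff]
    rw [← Finset.mul_prod_erase _ _ (Finset.mem_univ j),
      ← Finset.mul_prod_erase _ _ (Finset.mem_univ j),
      ← Finset.mul_prod_erase _ _ (Finset.mem_univ j)]
    have e1 : ∏ i ∈ Finset.univ.erase j, (if i ∈ l then
        f i ((k - (0, Pi.single j 1)).1 i) ((k - (0, Pi.single j 1)).2 i) -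
          f i ((k - (0, Pi.single j 1)).1 i) ((k - (0, Pi.single j 1)).2 i - 1)
        else f i ((k - (0, Pi.single j 1)).1 i) ((k - (0, Pi.single j 1)).2 i)) =
        ∏ i ∈ Finset.univ.erase j, if i ∈ l then f i (k.1 i) (k.2 i) - f i (k.1 i) (k.2 i - 1)
      else f i (k.1 i) (k.2 i) := by
      refine Finset.prod_congr rfl fun i hi => ?_
      simp [Finset.ne_of_mem_erase hi]
    have e2 : ∏ i ∈ Finset.univ.erase j, (if i ∈ j :: l then
        f i (k.1 i) (k.2 i) - f i (k.1 i) (k.2 i - 1) else f i (k.1 i) (k.2 i)) =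
        ∏ i ∈ Finset.univ.erase j, if i ∈ l then f i (k.1 i) (k.2 i) - f i (k.1 i) (k.2 i - 1)
      else f i (k.1 i) (k.2 i) := by
      refine Finset.prod_congr rfl fun i hi => ?_
      simp [Finset.ne_of_mem_erase hi]
    rw [e1, e2, ← sub_mul]
    simp [hj]

theorem sum_Icc_sub_sum_Icc_sub_one (g : ℤ → ℂ) {p q : ℤ} (h : p ≤ q) :
    ∑ m ∈ Finset.Icc p q, g m - ∑ m ∈ Finset.Icc p (q - 1), g m = g q := by
  have : Finset.Icc p q = insert q (Finset.Icc p (q - 1)) := by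
    ext m; simp only [Finset.mem_insert, Finset.mem_Icc]; omega
  rw [this, Finset.sum_insert (by simp)]
  ring

end Box

/-- The unit vectors of `ℤ^d × ℤ^d`. -/
def unitVectors (d : ℕ) : List ((Fin d → ℤ) × (Fin d → ℤ)) :=
  ((List.finRange d).map fun i => (Pi.single i 1, 0)) ++
    (List.finRange d).map fun i => (0, Pi.single i 1)

theorem bdiffList_unitVectors {d : ℕ} (lo lo' : Fin d → ℤ) (f : Fin d → ℤ → ℤ → ℂ)
    (k : (Fin d → ℤ) × (Fin d → ℤ)) (hk : ∀ i, lo i ≤ k.1 i) (hk' : ∀ i, lo' i ≤ k.2 i) :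
    bdiffList (unitVectors d) (fun k => ∏ i, ∑ m ∈ Finset.Icc (lo i) (k.1 i),
      ∑ n ∈ Finset.Icc (lo' i) (k.2 i), f i m n) k = ∏ i, f i (k.1 i) (k.2 i) := by
  rw [unitVectors, bdiffList, List.foldr_append, ← bdiffList, ← bdiffList,
    bdiffList_single_inr (fun i p q => ∑ m ∈ Finset.Icc (lo i) p,
      ∑ n ∈ Finset.Icc (lo' i) q, f i m n) (List.nodup_finRange d)]
  simp only [List.mem_finRange, if_true]
  rw [bdiffList_single_inl (fun i p q => ∑ m ∈ Finset.Icc (lo i) p,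
      ∑ n ∈ Finset.Icc (lo' i) q, f i m n - ∑ m ∈ Finset.Icc (lo i) p,
      ∑ n ∈ Finset.Icc (lo' i) (q - 1), f i m n) (List.nodup_finRange d)]
  simp only [List.mem_finRange, if_true]
  refine Finset.prod_congr rfl fun i _ => ?_
  simp only [← Finset.sum_sub_distrib, sum_Icc_sub_sum_Icc_sub_one _ (hk' i)]
  exact sum_Icc_sub_sum_Icc_sub_one _ (hk i)

/-- Summation by parts bound for a bilinear exponential sum over a box. -/
theorem norm_tsum_mul_prod_efun_le {d : ℕ} (J : ℕ) (lo lo' : Fin d → ℤ)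
    {F : (Fin d → ℤ) × (Fin d → ℤ) → ℂ} {A : ℝ} (hA : ∀ k, ‖fdiffList (unitVectors d) F k‖ ≤ A)
    (hF : ∀ k, F k ≠ 0 → ∀ i, (lo i ≤ k.1 i ∧ k.1 i < lo i + 2 ^ J) ∧
      (lo' i ≤ k.2 i ∧ k.2 i < lo' i + 2 ^ J)) (ξ ζ : Fin d → ℝ) (θ : ℝ) :
    ‖∑' k, F k * ∏ i, efun (k.1 i * ξ i + k.2 i * ζ i + θ * (k.1 i * k.2 i))‖ ≤
      A * (2 ^ J) ^ (2 * d) * bilinearBound J θ ^ d := by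
  set e : Fin d → ℤ → ℤ → ℂ := fun i m n => efun (m * ξ i + n * ζ i + θ * (m * n)) with he
  set B : Finset ((Fin d → ℤ) × (Fin d → ℤ)) :=
    (Fintype.piFinset fun i => Finset.Ico (lo i) (lo i + 2 ^ J)) ×ˢ
      (Fintype.piFinset fun i => Finset.Ico (lo' i) (lo' i + 2 ^ J)) with hB
  have memB : ∀ k, k ∈ B ↔ ∀ i, (lo i ≤ k.1 i ∧ k.1 i < lo i + 2 ^ J) ∧
      (lo' i ≤ k.2 i ∧ k.2 i < lo' i + 2 ^ J) := by
    intro k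
    simp only [hB, Finset.mem_product, Fintype.mem_piFinset, Finset.mem_Ico, forall_and]
  have hfin : F.support.Finite := B.finite_toSet.subset fun k hk => (memB k).mpr (hF k hk)
  set S : (Fin d → ℤ) × (Fin d → ℤ) → ℂ := fun k => ∏ i, ∑ m ∈ Finset.Icc (lo i) (k.1 i),
      ∑ n ∈ Finset.Icc (lo' i) (k.2 i), e i m n with hS
  have h1 : ∑' k, F k * ∏ i, e i (k.1 i) (k.2 i) = ∑' k, fdiffList (unitVectors d) F k * S k := by
    rw [← tsum_mul_bdiffList _ hfin]
    refine tsum_congr fun k => ?_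
    by_cases hk : F k = 0
    · simp [hk]
    · rw [bdiffList_unitVectors lo lo' e k (fun i => (hF k hk i).1.1) fun i => (hF k hk i).2.1]
  have hzero : ∀ k, k ∉ B → fdiffList (unitVectors d) F k * S k = 0 := by
    intro k hk
    rw [memB] at hk
    push Not at hk
    obtain ⟨i, hi⟩ := hk
    have hmem : ∀ v ∈ unitVectors d, 0 ≤ v := by
      intro v hv
      simp only [unitVectors, List.mem_append, List.mem_map, List.mem_finRange, true_and] at hv
      rcases hv with ⟨j, rfl⟩ | ⟨j, rfl⟩ <;> simp [Prod.le_def]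
    rcases lt_or_ge (k.1 i) (lo i) with h | h
    · rw [hS]
      refine mul_eq_zero_of_right _ (Finset.prod_eq_zero (Finset.mem_univ i) ?_)
      rw [Finset.Icc_eq_empty (by omega), Finset.sum_empty]
    rcases lt_or_ge (k.2 i) (lo' i) with h' | h'
    · rw [hS]
      refine mul_eq_zero_of_right _ (Finset.prod_eq_zero (Finset.mem_univ i) ?_)
      have hemp : Finset.Icc (lo' i) (k.2 i) = ∅ := Finset.Icc_eq_empty (by omega)
      simp [hemp]
    refine mul_eq_zero_of_left (fdiffList_eq_zero
      (U := {k | lo i + 2 ^ J ≤ k.1 i ∨ lo' i + 2 ^ J ≤ k.2 i}) ?_ ?_ k ?_) _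
    · intro v hv k hk
      have h1 : 0 ≤ v.1 i := (hmem v hv).1 i
      have h2 : 0 ≤ v.2 i := (hmem v hv).2 i
      simp only [Set.mem_ofPred_eq, Prod.fst_add, Prod.snd_add, Pi.add_apply] at hk ⊢
      rcases hk with hk | hk
      · left; linarith
      · right; linarith
    · intro k hk
      by_contra hne
      have := hF k hne i
      rcases hk with hk | hk <;> linarith [this.1.2, this.2.2]
    · by_contra hne
      simp only [Set.mem_ofPred_eq, not_or, not_le] at hne
      exact absurd (hi ⟨h, hne.1⟩ h') (by linarith [hne.2])
  rw [h1, tsum_eq_sum (s := B) fun k hk => hzero k hk]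
  have hA0 : 0 ≤ A := (norm_nonneg _).trans (hA 0)
  have hcard : (B.card : ℝ) = (2 ^ J) ^ (2 * d) := by
    rw [hB, Finset.card_product, Fintype.card_piFinset, Fintype.card_piFinset]
    have htwo : ((2 : ℤ) ^ J).toNat = 2 ^ J := by
      rw [← Nat.cast_ofNat, ← Nat.cast_pow, Int.toNat_natCast]
    simp [two_mul, pow_add, htwo]
  calc _ ≤ ∑ k ∈ B, A * bilinearBound J θ ^ d := by
        refine norm_sum_le_of_le _ fun k hk => ?_
        rw [norm_mul]
        refine mul_le_mul (hA k) ?_ (norm_nonneg _) hA0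
        rw [hS]
        simp only [norm_prod]
        refine (Finset.prod_le_prod (g := fun _ => bilinearBound J θ)
          (fun i _ => norm_nonneg _) fun i _ => ?_).trans_eq (by simp)
        have := (memB k).mp hk i
        refine norm_bilinear_sum_le J θ (ξ i) (ζ i) _ _ _ _ ?_ ?_
        · rw [Int.card_Icc, Int.toNat_le]; push_cast; linarith [this.1.2]
        · rw [Int.card_Icc, Int.toNat_le]; push_cast; linarith [this.2.2]
    _ = _ := by
        rw [Finset.sum_const, nsmul_eq_mul, hcard]; ring

section DiffBound

variable {M : Type*} [AddCommGroup M]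

/-- Every iterated difference of `F` along a sublist of `l` of length `m` is at most `A * h ^ m`. -/
def DiffBound (h : ℝ) : List M → ℝ → (M → ℂ) → Prop
  | [], A, F => ∀ k, ‖F k‖ ≤ A
  | v :: l, A, F => DiffBound h l A F ∧ DiffBound h l (A * h) (fdiff v F)

namespace DiffBound

variable {h A B : ℝ} {l : List M} {F G : M → ℂ}

theorem norm_le (hF : DiffBound h l A F) (k : M) : ‖F k‖ ≤ A := by
  induction l with
  | nil => exact hF k
  | cons v l ih => exact ih hF.1

theorem norm_fdiffList_le (hF : DiffBound h l A F) (k : M) :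
    ‖fdiffList l F k‖ ≤ A * h ^ l.length := by
  induction l generalizing A F with
  | nil => simpa [fdiffList] using hF k
  | cons v l ih => exact (ih hF.2).trans_eq (by rw [List.length_cons]; ring)

theorem of_le (hF : DiffBound h l A F) (hh : 0 ≤ h) (hAB : A ≤ B) : DiffBound h l B F := by
  induction l generalizing A B F with
  | nil => exact fun k => (hF k).trans hAB
  | cons v l ih => exact ⟨ih hF.1 hAB, ih hF.2 (by gcongr)⟩

theorem add (hF : DiffBound h l A F) (hG : DiffBound h l B G) :
    DiffBound h l (A + B) (fun k => F k + G k) := by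
  induction l generalizing A B F G with
  | nil => exact fun k => (norm_add_le _ _).trans (add_le_add (hF k) (hG k))
  | cons v l ih =>
    refine ⟨ih hF.1 hG.1, ?_⟩
    have := ih hF.2 hG.2
    convert this using 1
    · ring
    · funext k; simp only [fdiff]; ring

theorem comp_add_right (hF : DiffBound h l A F) (w : M) : DiffBound h l A fun k => F (k + w) := by
  induction l generalizing A F with
  | nil => exact fun k => hF _
  | cons v l ih =>
    refine ⟨ih hF.1, ?_⟩
    have := ih hF.2
    convert this using 1
    funext k; simp only [fdiff, add_right_comm]

theorem mul (hh : 0 ≤ h) (hF : DiffBound h l A F) (hG : DiffBound h l B G) :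
    DiffBound h l (2 ^ l.length * A * B) fun k => F k * G k := by
  induction l generalizing A B F G with
  | nil =>
    intro k
    rw [norm_mul, List.length_nil, pow_zero, one_mul]
    exact mul_le_mul (hF k) (hG k) (norm_nonneg _) ((norm_nonneg _).trans (hF k))
  | cons v l ih =>
    have hA : 0 ≤ A := (norm_nonneg _).trans (hF.1.norm_le 0)
    have hB : 0 ≤ B := (norm_nonneg _).trans (hG.1.norm_le 0)
    refine ⟨(ih hF.1 hG.1).of_le hh ?_, ?_⟩
    · rw [List.length_cons]
      gcongr
      · norm_num
      · exact Nat.le_succ _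
    · have h2 := (ih hF.2 hG.1).add (ih (hF.1.comp_add_right v) hG.2)
      convert h2 using 1
      · rw [List.length_cons]; ring
      · funext k; simp only [fdiff]; ring

theorem zero (hh : 0 ≤ h) (hA : 0 ≤ A) : DiffBound h l A (0 : M → ℂ) := by
  induction l generalizing A with
  | nil => simpa [DiffBound] using hA
  | cons v l ih =>
    have hz : fdiff v (0 : M → ℂ) = 0 := by funext k; simp [fdiff]
    refine ⟨ih hA, ?_⟩
    rw [hz]
    exact ih (by positivity)

theorem of_invariant (hh : 0 ≤ h) (hF : ∀ k, ‖F k‖ ≤ A)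
    (hinv : ∀ v ∈ l, ∀ k, F (k + v) = F k) : DiffBound h l A F := by
  induction l with
  | nil => exact hF
  | cons v l ih =>
    have hz : fdiff v F = 0 := by
      funext k
      rw [fdiff, hinv v List.mem_cons_self k, sub_self, Pi.zero_apply]
    have hA : 0 ≤ A := (norm_nonneg _).trans (hF 0)
    exact ⟨ih fun w hw => hinv w (List.mem_cons_of_mem _ hw), hz ▸ zero hh (by positivity)⟩

theorem of_invariant_except (hh : 0 ≤ h) (hl : l.Nodup) (v₀ : M) (hF : ∀ k, ‖F k‖ ≤ A)
    (hF' : ∀ k, ‖fdiff v₀ F k‖ ≤ A * h) (hinv : ∀ v ∈ l, v ≠ v₀ → ∀ k, F (k + v) = F k) :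
    DiffBound h l A F := by
  induction l with
  | nil => exact hF
  | cons v l ih =>
    obtain ⟨hv, hl⟩ := List.nodup_cons.mp hl
    have hA : 0 ≤ A := (norm_nonneg _).trans (hF 0)
    refine ⟨ih hl fun w hw => hinv w (List.mem_cons_of_mem _ hw), ?_⟩
    by_cases hvv : v = v₀
    · subst hvv
      refine of_invariant hh hF' fun w hw k => ?_
      have hw' : ∀ k, F (k + w) = F k :=
        hinv w (List.mem_cons_of_mem _ hw) (ne_of_mem_of_not_mem hw hv)
      rw [fdiff, fdiff, hw', add_right_comm, hw']
    · have hz : fdiff v F = 0 := by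
        funext k
        rw [fdiff, hinv v List.mem_cons_self hvv k, sub_self, Pi.zero_apply]
      exact hz ▸ zero hh (by positivity)

theorem prod {ι : Type*} (hh : 0 ≤ h) (s : Finset ι) {F : ι → M → ℂ}
    (hF : ∀ i ∈ s, DiffBound h l A (F i)) :
    DiffBound h l ((2 ^ l.length * A) ^ s.card) fun k => ∏ i ∈ s, F i k := by
  classical
  induction s using Finset.induction_on with
  | empty => exact of_invariant hh (by simp) (by simp)
  | insert i s hi ih =>
    have := mul hh (hF i (Finset.mem_insert_self i s))
      (ih fun j hj => hF j (Finset.mem_insert_of_mem hj))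
    simp only [Finset.prod_insert hi, Finset.card_insert_of_notMem hi]
    convert this using 1
    ring

theorem comp_addMonoidHom {M' : Type*} [AddCommGroup M'] (φ : M →+ M') {F : M' → ℂ}
    (hF : DiffBound h (l.map φ) A F) : DiffBound h l A fun k => F (φ k) := by
  induction l generalizing A F with
  | nil => exact fun k => hF _
  | cons v l ih =>
    refine ⟨ih hF.1, ?_⟩
    have := ih hF.2
    convert this using 1
    funext k
    simp only [fdiff, map_add]

end DiffBound
end DiffBound

section PartialDerivatives

variable {X : Type*} [NormedAddCommGroup X] [NormedSpace ℝ X]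

theorem ContDiff.pderivAlong {f : X → ℂ} {m n : ℕ∞} (hf : ContDiff ℝ n f) (hmn : m + 1 ≤ n)
    (v : X) : ContDiff ℝ m (pderivAlong v f) :=
  (hf.fderiv_right (by exact_mod_cast hmn)).clm_apply contDiff_const

theorem ContDiff.pderivList {f : X → ℂ} {m n : ℕ} (hf : ContDiff ℝ n f) {l : List X}
    (hmn : m + l.length ≤ n) : ContDiff ℝ m (pderivList l f) := by
  induction l generalizing m with
  | nil => exact hf.of_le (by exact_mod_cast hmn)
  | cons v l ih =>
    rw [List.length_cons] at hmn
    exact ContDiff.pderivAlong (n := (m + 1 : ℕ)) (ih (m := m + 1) (by omega)) (by simp) v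

theorem pderivList_differentiable {f : X → ℂ} {n : ℕ} (hf : ContDiff ℝ n f) {l : List X}
    (hl : l.length + 1 ≤ n) : Differentiable ℝ (pderivList l f) :=
  (hf.pderivList (m := 1) (by omega)).differentiable (by norm_num)

theorem pderivList_fdiff {f : X → ℂ} {n : ℕ} (hf : ContDiff ℝ n f) {l : List X}
    (hl : l.length ≤ n) (w : X) : pderivList l (fdiff w f) = fdiff w (pderivList l f) := by
  induction l with
  | nil => rfl
  | cons v l ih =>
    rw [List.length_cons] at hl
    have hd := pderivList_differentiable hf hl
    have h : pderivList l (fdiff w f) = fdiff w (pderivList l f) := ih (by omega)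
    simp only [pderivList, List.foldr_cons] at h hd ⊢
    rw [h]
    funext x
    set g := List.foldr pderivAlong f l
    change fderiv ℝ (fun k => g k - g (k + w)) x v = fderiv ℝ g x v - fderiv ℝ g (x + w) v
    have hw : DifferentiableAt ℝ (fun k => g (k + w)) x :=
      hd.comp (differentiable_id.add_const w) x
    rw [fderiv_fun_sub (hd x) hw, fderiv_comp_add_right]
    rfl

theorem norm_fdiff_smul_le {f : X → ℂ} (hf : Differentiable ℝ f) {v : X} {A h : ℝ} (hh : 0 ≤ h)
    (hA : ∀ x, ‖pderivAlong v f x‖ ≤ A) (x : X) : ‖fdiff (h • v) f x‖ ≤ A * h := by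
  have hderiv : ∀ t : ℝ,
      HasDerivAt (fun t : ℝ => f (x + t • v)) (pderivAlong v f (x + t • v)) t := by
    intro t
    have h1 : HasDerivAt (fun t : ℝ => x + t • v) v t := by
      simpa using ((hasDerivAt_id t).smul_const v).const_add x
    exact (hf (x + t • v)).hasFDerivAt.comp_hasDerivAt t h1
  have := norm_image_sub_le_of_norm_deriv_le_segment' (a := 0) (b := h)
    (fun t _ => (hderiv t).hasDerivWithinAt) (fun t _ => hA _) h ⟨hh, le_rfl⟩
  rw [norm_sub_rev] at this
  simpa [fdiff] using this

/-- Bounds on partial derivatives control iterated differences. -/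
theorem DiffBound.of_pderivList {n : ℕ} {h : ℝ} (hh : 0 ≤ h) {l : List X} (hl : l.length ≤ n)
    {f : X → ℂ} (hf : ContDiff ℝ n f) {A : ℝ}
    (hA : ∀ l' : List X, l'.Sublist l → ∀ x, ‖pderivList l' f x‖ ≤ A) :
    DiffBound h (l.map (h • ·)) A f := by
  induction l generalizing f A with
  | nil => exact hA [] (List.Sublist.refl _)
  | cons v l ih =>
    rw [List.length_cons] at hl
    refine ⟨ih (by omega) hf fun l' hl' => hA l' (hl'.cons _), ih (by omega) ?_ fun l' hl' x => ?_⟩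
    · exact hf.sub (hf.comp (contDiff_id.add contDiff_const))
    · have hlen := hl'.length_le
      rw [pderivList_fdiff hf (by omega)]
      exact norm_fdiff_smul_le (pderivList_differentiable hf (by omega)) hh
        (hA (v :: l') (hl'.cons_cons v)) x

variable {Y : Type*} [NormedAddCommGroup Y] [NormedSpace ℝ Y]

theorem pderivList_map_inr {f : X × Y → ℂ} {n : ℕ} (hf : ContDiff ℝ n f) {l : List Y}
    (hl : l.length ≤ n) (x : X) (y : Y) :
    pderivList (l.map fun v => ((0, v) : X × Y)) f (x, y) =
      pderivList l (fun y' => f (x, y')) y := by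
  induction l generalizing y with
  | nil => rfl
  | cons v l ih =>
    rw [List.length_cons] at hl
    have hd := pderivList_differentiable hf (l := l.map fun v => ((0, v) : X × Y))
      (by simpa using hl)
    have h : (fun y => pderivList (l.map fun v => ((0, v) : X × Y)) f (x, y)) =
        pderivList l (fun y' => f (x, y')) := funext fun y => ih (by omega) y
    change fderiv ℝ (pderivList (l.map fun v => ((0, v) : X × Y)) f) (x, y) (0, v) =
      fderiv ℝ (pderivList l fun y' => f (x, y')) y v
    have hc := HasFDerivAt.comp y (hd (x, y)).hasFDerivAt (hasFDerivAt_prodMk_right (𝕜 := ℝ) x y)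
    rw [← h]
    exact (congrArg (· v) hc.fderiv).symm

theorem pderivList_map_inl {f : X × Y → ℂ} {n : ℕ} (hf : ContDiff ℝ n f) {l : List X}
    (hl : l.length ≤ n) (x : X) (y : Y) :
    pderivList (l.map fun v => ((v, 0) : X × Y)) f (x, y) =
      pderivList l (fun x' => f (x', y)) x := by
  induction l generalizing x with
  | nil => rfl
  | cons v l ih =>
    rw [List.length_cons] at hl
    have hd := pderivList_differentiable hf (l := l.map fun v => ((v, 0) : X × Y))
      (by simpa using hl)
    have h : (fun x => pderivList (l.map fun v => ((v, 0) : X × Y)) f (x, y)) =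
        pderivList l (fun x' => f (x', y)) := funext fun x => ih (by omega) x
    change fderiv ℝ (pderivList (l.map fun v => ((v, 0) : X × Y)) f) (x, y) (v, 0) =
      fderiv ℝ (pderivList l fun x' => f (x', y)) x v
    have hc := HasFDerivAt.comp x (hd (x, y)).hasFDerivAt (hasFDerivAt_prodMk_left (𝕜 := ℝ) x y)
    rw [← h]
    exact (congrArg (· v) hc.fderiv).symm

end PartialDerivatives

theorem unitVectors_nodup (d : ℕ) : (unitVectors d).Nodup := by
  refine List.Nodup.append ((List.nodup_finRange d).map fun i j h => ?_)
    ((List.nodup_finRange d).map fun i j h => ?_) ?_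
  · by_contra hij
    have := congrFun (congrArg Prod.fst h) i
    simp [hij] at this
  · by_contra hij
    have := congrFun (congrArg Prod.snd h) i
    simp [hij] at this
  · intro v hv hv'
    simp only [List.mem_map, List.mem_finRange, true_and] at hv hv'
    obtain ⟨i, rfl⟩ := hv
    obtain ⟨j, hj⟩ := hv'
    have := congrFun (congrArg Prod.fst hj) i
    simp at this

theorem length_unitVectors (d : ℕ) : (unitVectors d).length = 2 * d := by
  simp [unitVectors, two_mul]

/-- The point of `(L⁻¹ℤ)^d × (L⁻¹ℤ)^d` with integer coordinates `k`. -/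
def latticePoint (d : ℕ) (L : ℝ) :
    (Fin d → ℤ) × (Fin d → ℤ) →+ EuclideanSpace ℝ (Fin d) × EuclideanSpace ℝ (Fin d) where
  toFun k := (WithLp.toLp 2 fun i => (k.1 i : ℝ) / L, WithLp.toLp 2 fun i => (k.2 i : ℝ) / L)
  map_zero' := by ext <;> simp
  map_add' k k' := by ext <;> simp [add_div]

theorem map_latticePoint_unitVectors (d : ℕ) (L : ℝ) :
    (unitVectors d).map (latticePoint d L) =
      (((List.finRange d).map fun i => EuclideanSpace.single i (1 : ℝ)).map (fun v => (v, 0)) ++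
        ((List.finRange d).map fun i => EuclideanSpace.single i (1 : ℝ)).map
          fun v => ((0, v) : EuclideanSpace ℝ (Fin d) × EuclideanSpace ℝ (Fin d))).map
        (L⁻¹ • ·) := by
  simp only [unitVectors, List.map_append, List.map_map]
  congr 1 <;>
  · refine List.map_congr_left fun i _ => ?_
    ext j <;> by_cases hij : j = i <;> simp [latticePoint, hij, Pi.single_apply]

theorem PhiDerivBound.norm_pderivList_le {d : ℕ} {D : ℝ}
    {Φ : ℝ → EuclideanSpace ℝ (Fin d) → EuclideanSpace ℝ (Fin d) → ℂ} (hΦ : PhiDerivBound d D Φ)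
    {s : ℝ} (hs : ContDiff ℝ (20 * d : ℕ)
      (fun p : EuclideanSpace ℝ (Fin d) × EuclideanSpace ℝ (Fin d) => Φ s p.1 p.2))
    {l : List (EuclideanSpace ℝ (Fin d) × EuclideanSpace ℝ (Fin d))}
    (hl : l.Sublist (((List.finRange d).map fun i => EuclideanSpace.single i (1 : ℝ)).map
        (fun v => (v, 0)) ++
        ((List.finRange d).map fun i => EuclideanSpace.single i (1 : ℝ)).map fun v => (0, v)))
    (p : EuclideanSpace ℝ (Fin d) × EuclideanSpace ℝ (Fin d)) :
    ‖pderivList l (fun p => Φ s p.1 p.2) p‖ ≤ D := by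
  obtain ⟨l₁, l₂, rfl, h₁, h₂⟩ := List.sublist_append_iff.mp hl
  obtain ⟨m₁, hm₁, rfl⟩ := List.sublist_map_iff.mp h₁
  obtain ⟨m₂, hm₂, rfl⟩ := List.sublist_map_iff.mp h₂
  obtain ⟨lx, hlx, rfl⟩ := List.sublist_map_iff.mp hm₁
  obtain ⟨ly, hly, rfl⟩ := List.sublist_map_iff.mp hm₂
  have hx : lx.length ≤ d := by simpa using hlx.length_le
  have hy : ly.length ≤ d := by simpa using hly.length_le
  obtain ⟨x, y⟩ := p
  have hc := hs.pderivList (m := 19 * d)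
    (l := (ly.map fun i => EuclideanSpace.single i (1 : ℝ)).map
      fun v => ((0, v) : EuclideanSpace ℝ (Fin d) × EuclideanSpace ℝ (Fin d)))
    (by simp only [List.length_map]; omega)
  have happ : ∀ (l₁ l₂ : List (EuclideanSpace ℝ (Fin d) × EuclideanSpace ℝ (Fin d)))
      (f : EuclideanSpace ℝ (Fin d) × EuclideanSpace ℝ (Fin d) → ℂ),
      pderivList (l₁ ++ l₂) f = pderivList l₁ (pderivList l₂ f) := fun l₁ l₂ f =>
    List.foldr_append
  rw [happ, pderivList_map_inl hc (by simp only [List.length_map]; omega)]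
  simp only [pderivList_map_inr hs (l := ly.map fun i => EuclideanSpace.single i (1 : ℝ))
    (by simp only [List.length_map]; omega)]
  exact hΦ lx ly (by omega) (by omega) s x y

theorem exists_bound_sub_le {χ : ℝ → ℝ} (hχs : ContDiff ℝ (⊤ : ℕ∞) χ)
    (hχ0 : ∀ z : ℝ, 1 ≤ |z| → χ z = 0) :
    ∃ M : ℝ, 0 < M ∧ (∀ z, |χ z| ≤ M) ∧ ∀ z w, |χ z - χ w| ≤ M * |z - w| := by
  have hsupp : HasCompactSupport χ := by
    refine HasCompactSupport.intro (isCompact_Icc (a := (-1 : ℝ)) (b := 1)) fun z hz => hχ0 z ?_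
    by_contra! h
    exact hz ⟨(abs_lt.mp h).1.le, (abs_lt.mp h).2.le⟩
  obtain ⟨M₀, hM₀⟩ := hsupp.exists_bound_of_continuous hχs.continuous
  obtain ⟨M₁, hM₁⟩ := hsupp.deriv.exists_bound_of_continuous
    (hχs.continuous_deriv (by simp))
  have h0 : 0 ≤ M₀ := (norm_nonneg _).trans (hM₀ 0)
  have h1 : 0 ≤ M₁ := (norm_nonneg _).trans (hM₁ 0)
  refine ⟨M₀ + M₁ + 1, by positivity, fun z => (hM₀ z).trans (by linarith), fun z w => ?_⟩
  have := Convex.norm_image_sub_le_of_norm_deriv_le (s := Set.univ) (f := χ) (C := M₁)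
    (fun x _ => (hχs.differentiable (by simp)) x) (fun x _ => hM₁ x) convex_univ
    (Set.mem_univ w) (Set.mem_univ z)
  exact this.trans (mul_le_mul_of_nonneg_right (by linarith) (abs_nonneg _))

theorem diffBound_cutoff {K : Type*} [AddCommGroup K] {χ : ℝ → ℝ} {M : ℝ} (hM : ∀ z, |χ z| ≤ M)
    (hM' : ∀ z w, |χ z - χ w| ≤ M * |z - w|) {L lam : ℝ} (hL : 0 < L) (hlam : 1 ≤ lam) (a : ℝ)
    {l : List K} (hl : l.Nodup) (p : K →+ ℤ) (v₀ : K) (hv₀ : p v₀ = 1)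
    (hp : ∀ v ∈ l, v ≠ v₀ → p v = 0) :
    DiffBound L⁻¹ l M fun k => ((χ (lam⁻¹ * (p k / L - a)) : ℝ) : ℂ) := by
  have hM0 : 0 ≤ M := (abs_nonneg _).trans (hM 0)
  refine DiffBound.of_invariant_except (by positivity) hl v₀ (fun k => ?_) (fun k => ?_)
    fun v hv hvv k => ?_
  · simpa using hM _
  · rw [fdiff, ← Complex.ofReal_sub, Complex.norm_real, Real.norm_eq_abs]
    refine (hM' _ _).trans (mul_le_mul_of_nonneg_left ?_ hM0)
    rw [map_add, hv₀, abs_sub_comm]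
    push_cast
    have : lam⁻¹ * (((p k : ℝ) + 1) / L - a) - lam⁻¹ * ((p k : ℝ) / L - a) = lam⁻¹ * L⁻¹ := by
      ring
    rw [this, abs_of_nonneg (by positivity)]
    exact mul_le_of_le_one_left (by positivity) (inv_le_one_of_one_le₀ hlam)
  · simp only [map_add, hp v hv hvv, add_zero]

/-- The amplitude of the lattice sum as a function of the integer coordinates. -/
def latAmplitude (d : ℕ) (χ : ℝ → ℝ)
    (Φ : ℝ → EuclideanSpace ℝ (Fin d) → EuclideanSpace ℝ (Fin d) → ℂ)
    (lam L s : ℝ) (a b : EuclideanSpace ℝ (Fin d)) (k : (Fin d → ℤ) × (Fin d → ℤ)) : ℂ :=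
  Φ s (latticePoint d L k).1 (latticePoint d L k).2 *
    ((∏ i, ((χ (lam⁻¹ * (k.1 i / L - a i)) : ℝ) : ℂ)) *
      ∏ i, ((χ (lam⁻¹ * (k.2 i / L - b i)) : ℝ) : ℂ))

theorem exists_diffBound_latAmplitude (d : ℕ) {χ : ℝ → ℝ} (hχs : ContDiff ℝ (⊤ : ℕ∞) χ)
    (hχ0 : ∀ z : ℝ, 1 ≤ |z| → χ z = 0) :
    ∃ A : ℝ, 0 < A ∧ ∀ L lam D : ℝ, 0 < L → 1 ≤ lam →
    ∀ Φ : ℝ → EuclideanSpace ℝ (Fin d) → EuclideanSpace ℝ (Fin d) → ℂ,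
      (∀ s : ℝ, ContDiff ℝ (20 * d : ℕ)
        (fun p : EuclideanSpace ℝ (Fin d) × EuclideanSpace ℝ (Fin d) => Φ s p.1 p.2)) →
      PhiDerivBound d D Φ → ∀ (s : ℝ) (a b : EuclideanSpace ℝ (Fin d)),
      DiffBound L⁻¹ (unitVectors d) (A * D) (latAmplitude d χ Φ lam L s a b) := by
  obtain ⟨M, hM0, hM, hM'⟩ := exists_bound_sub_le hχs hχ0
  refine ⟨2 ^ (2 * d) * (2 ^ (2 * d) * (2 ^ (2 * d) * M) ^ d * (2 ^ (2 * d) * M) ^ d),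
    by positivity, fun L lam D hL hlam Φ hΦs hΦ s a b => ?_⟩
  have hL' : 0 ≤ L⁻¹ := by positivity
  have h1 : DiffBound L⁻¹ (unitVectors d) D
      fun k => Φ s (latticePoint d L k).1 (latticePoint d L k).2 := by
    refine DiffBound.comp_addMonoidHom (latticePoint d L) (F := fun p => Φ s p.1 p.2) ?_
    rw [map_latticePoint_unitVectors]
    exact DiffBound.of_pderivList hL' (n := 20 * d)
      (by simp only [List.length_append, List.length_map, List.length_finRange]; omega) (hΦs s)
      fun l' hl' => hΦ.norm_pderivList_le (hΦs s) hl'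
  have hmem : ∀ v ∈ unitVectors d, (∃ j, v = (Pi.single j 1, 0)) ∨ ∃ j, v = (0, Pi.single j 1) := by
    intro v hv
    simpa [unitVectors, eq_comm] using hv
  have h2 := DiffBound.prod hL' Finset.univ fun i (_ : i ∈ Finset.univ) =>
    diffBound_cutoff hM hM' hL hlam (a i) (unitVectors_nodup d)
      ((Pi.evalAddMonoidHom (fun _ : Fin d => ℤ) i).comp
        (AddMonoidHom.fst (Fin d → ℤ) (Fin d → ℤ))) (Pi.single i 1, 0) (by simp) (by
        intro v hv hvi
        rcases hmem v hv with ⟨j, rfl⟩ | ⟨j, rfl⟩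
        · have hij : i ≠ j := by rintro rfl; exact hvi rfl
          simp [hij]
        · simp)
  have h3 := DiffBound.prod hL' Finset.univ fun i (_ : i ∈ Finset.univ) =>
    diffBound_cutoff hM hM' hL hlam (b i) (unitVectors_nodup d)
      ((Pi.evalAddMonoidHom (fun _ : Fin d => ℤ) i).comp
        (AddMonoidHom.snd (Fin d → ℤ) (Fin d → ℤ))) (0, Pi.single i 1) (by simp) (by
        intro v hv hvi
        rcases hmem v hv with ⟨j, rfl⟩ | ⟨j, rfl⟩
        · simp
        · have hij : i ≠ j := by rintro rfl; exact hvi rfl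
          simp [hij])
  have h4 := DiffBound.mul hL' h1 (DiffBound.mul hL' h2 h3)
  simp only [length_unitVectors, Finset.card_univ, Fintype.card_fin] at h4
  convert h4 using 1
  · ring
  · rfl

theorem efun_sum {ι : Type*} (s : Finset ι) (f : ι → ℝ) :
    efun (∑ i ∈ s, f i) = ∏ i ∈ s, efun (f i) := by
  classical
  induction s using Finset.induction_on with
  | empty => simp [efun]
  | insert i s hi ih => rw [Finset.sum_insert hi, Finset.prod_insert hi, efun_add, ih]

/-- Integer coordinates on the rescaled lattice. -/
def zLatEquiv (d : ℕ) {L : ℝ} (hL : 0 < L) : (Fin d → ℤ) ≃ ZLat d L :=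
  Equiv.ofBijective (fun m => ⟨WithLp.toLp 2 fun i => (m i : ℝ) / L, fun i => ⟨m i, rfl⟩⟩) <| by
    refine ⟨fun m m' h => funext fun i => ?_, fun ⟨x, hx⟩ => ?_⟩
    · have h1 : (m i : ℝ) / L = m' i / L :=
        congrArg (fun x : ZLat d L => (x : EuclideanSpace ℝ (Fin d)) i) h
      exact_mod_cast (div_left_inj' hL.ne').mp h1
    · choose m hm using id hx
      refine ⟨m, Subtype.ext ?_⟩
      ext i
      exact (hm i).symm

theorem latSum_eq_tsum (d : ℕ) (χ : ℝ → ℝ)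
    (Φ : ℝ → EuclideanSpace ℝ (Fin d) → EuclideanSpace ℝ (Fin d) → ℂ) {L : ℝ} (hL : 0 < L)
    (lam s : ℝ) (a b ξ ζ : EuclideanSpace ℝ (Fin d)) :
    latSum d χ Φ lam L s a b ξ ζ = ∑' k : (Fin d → ℤ) × (Fin d → ℤ),
      latAmplitude d χ Φ lam L s a b k *
        ∏ i, efun (k.1 i * (ξ i / L) + k.2 i * (ζ i / L) + s / L ^ 2 * (k.1 i * k.2 i)) := by
  rw [latSum, ← (Equiv.prodCongr (zLatEquiv d hL) (zLatEquiv d hL)).tsum_eq]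
  refine tsum_congr fun k => ?_
  have hx : (((Equiv.prodCongr (zLatEquiv d hL) (zLatEquiv d hL)) k).1 : EuclideanSpace ℝ (Fin d)) =
      (latticePoint d L k).1 := rfl
  have hy : (((Equiv.prodCongr (zLatEquiv d hL) (zLatEquiv d hL)) k).2 : EuclideanSpace ℝ (Fin d)) =
      (latticePoint d L k).2 := rfl
  rw [hx, hy, latAmplitude, ← efun_sum]
  beta_reduce
  congr 1
  · congr 1
    simp [cutoffProd, latticePoint]
  · congr 1
    simp only [PiLp.inner_apply, Finset.mul_sum, ← Finset.sum_add_distrib]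
    refine Finset.sum_congr rfl fun i _ => ?_
    simp [latticePoint]
    field_simp

theorem exists_norm_latSum_le (d : ℕ) {χ : ℝ → ℝ} (hχs : ContDiff ℝ (⊤ : ℕ∞) χ)
    (hχ0 : ∀ z : ℝ, 1 ≤ |z| → χ z = 0) :
    ∃ A : ℝ, 0 < A ∧ ∀ (L lam D : ℝ) (J : ℕ), 0 < L → 1 ≤ lam → 2 * (lam * L) ≤ 2 ^ J →
    ∀ Φ : ℝ → EuclideanSpace ℝ (Fin d) → EuclideanSpace ℝ (Fin d) → ℂ,
      (∀ s : ℝ, ContDiff ℝ (20 * d : ℕ)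
        (fun p : EuclideanSpace ℝ (Fin d) × EuclideanSpace ℝ (Fin d) => Φ s p.1 p.2)) →
      PhiDerivBound d D Φ → ∀ (s : ℝ) (a b ξ ζ : EuclideanSpace ℝ (Fin d)),
      ‖latSum d χ Φ lam L s a b ξ ζ‖ ≤
        A * D * (2 ^ J / L) ^ (2 * d) * bilinearBound J (s / L ^ 2) ^ d := by
  obtain ⟨A, hA0, hA⟩ := exists_diffBound_latAmplitude d hχs hχ0
  refine ⟨A, hA0, fun L lam D J hL hlam hJ Φ hΦs hΦ s a b ξ ζ => ?_⟩
  have hlam0 : 0 < lam := by linarith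
  have hrange : ∀ (c : ℝ) (m : ℤ), χ (lam⁻¹ * (m / L - c)) ≠ 0 →
      ⌈L * (c - lam)⌉ ≤ m ∧ m < ⌈L * (c - lam)⌉ + 2 ^ J := by
    intro c m hm
    have h1 : |lam⁻¹ * (m / L - c)| < 1 := by
      by_contra! h
      exact hm (hχ0 _ h)
    rw [abs_mul, abs_of_pos (by positivity), inv_mul_lt_iff₀ hlam0, mul_one, abs_lt,
      lt_sub_iff_add_lt, sub_lt_iff_lt_add, lt_div_iff₀ hL, div_lt_iff₀ hL] at h1
    have h2 := Int.le_ceil (L * (c - lam))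
    refine ⟨Int.ceil_le.mpr (by linarith), ?_⟩
    have h3 : (m : ℝ) < (⌈L * (c - lam)⌉ : ℝ) + 2 ^ J := by linarith
    exact_mod_cast h3
  rw [latSum_eq_tsum d χ Φ hL]
  refine (norm_tsum_mul_prod_efun_le J (fun i => ⌈L * (a i - lam)⌉) (fun i => ⌈L * (b i - lam)⌉)
    (hA L lam D hL hlam Φ hΦs hΦ s a b).norm_fdiffList_le ?_ _ _ _).trans_eq ?_
  · intro k hk i
    have h1 := right_ne_zero_of_mul hk
    have h2 := Finset.prod_ne_zero_iff.mp (left_ne_zero_of_mul h1) i (Finset.mem_univ i)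
    have h3 := Finset.prod_ne_zero_iff.mp (right_ne_zero_of_mul h1) i (Finset.mem_univ i)
    exact ⟨hrange _ _ (Complex.ofReal_ne_zero.mp h2), hrange _ _ (Complex.ofReal_ne_zero.mp h3)⟩
  · rw [length_unitVectors, div_pow, inv_pow]
    ring

theorem statement14 (d : ℕ) (hd : 3 ≤ d) (γ : ℝ) (hγ : 0 < γ) (hγ' : γ < 1) (χ₀ : ℝ → ℝ)
    (hχs : ContDiff ℝ (⊤ : ℕ∞) χ₀)
    (hχ1 : ∀ z : ℝ, |z| ≤ 1 / 2 → χ₀ z = 1)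
    (hχ0 : ∀ z : ℝ, 1 ≤ |z| → χ₀ z = 0) :
    ∃ η₀ : ℝ, 0 < η₀ ∧ ∀ η : ℝ, 0 < η → η ≤ η₀ →
    ∃ C : ℝ, 2 ≤ C ∧
    ∀ L : ℝ, C ≤ L →
    ∀ lam : ℝ, 1 ≤ lam → lam ≤ Real.log L ^ 4 →
    ∀ D : ℝ, 0 < D →
    ∀ Φ : ℝ → EuclideanSpace ℝ (Fin d) → EuclideanSpace ℝ (Fin d) → ℂ,
      (∀ s : ℝ, ContDiff ℝ (20 * d : ℕ)
        (fun p : EuclideanSpace ℝ (Fin d) × EuclideanSpace ℝ (Fin d) => Φ s p.1 p.2)) →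
      PhiDerivBound d D Φ →
      (∀ (s : ℝ) (x y : EuclideanSpace ℝ (Fin d)), L ^ (2 * γ) ≤ |s| → Φ s x y = 0) →
    ∀ a b ξ ζ : EuclideanSpace ℝ (Fin d),
      (∫⁻ s : ℝ, (‖latSum d χ₀ Φ lam L s a b ξ ζ‖₊ : ℝ≥0∞))
        ≤ ENNReal.ofReal (C * D * lam ^ (4 * (d : ℝ)) * L ^ (2 * (d : ℝ))) := by
  obtain ⟨A, hA0, hA⟩ := exists_norm_latSum_le d hχs hχ0
  obtain ⟨B, hB0, hB⟩ := exists_lintegral_bilinearBound_cube_le hγ' (c := 4) (by norm_num)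
  refine ⟨1, one_pos, fun η _ _ =>
    ⟨max 2 (A * 4 ^ (2 * d) * (64 ^ (d - 3)) * B), le_max_left _ _, ?_⟩⟩
  intro L hCL lam hlam _ D hD Φ hΦs hΦ hsupp a b ξ ζ
  have hL2 : 2 ≤ L := (le_max_left _ _).trans hCL
  have hL0 : 0 < L := by linarith
  have hlam0 : 0 < lam := by linarith
  have hlamL : 1 ≤ 2 * (lam * L) := by nlinarith
  obtain ⟨j, hj, hj'⟩ := exists_nat_pow_near hlamL (one_lt_two (α := ℝ))
  set J := j + 1
  have hJ : (2 : ℝ) ^ J ≤ 4 * (lam * L) := by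
    rw [pow_succ]; linarith
  set E : ℝ := A * D * (2 ^ J / L) ^ (2 * d) * (4 * (2 ^ J) ^ 2) ^ (d - 3) with hE
  have hE0 : 0 ≤ E := by positivity
  have hpt : ∀ s, (‖latSum d χ₀ Φ lam L s a b ξ ζ‖₊ : ℝ≥0∞) ≤
      {s : ℝ | |s| < L ^ (2 * γ)}.indicator
        (fun s => ENNReal.ofReal E * ENNReal.ofReal (bilinearBound J (s / L ^ 2) ^ 3)) s := by
    intro s
    by_cases hs : |s| < L ^ (2 * γ)
    · rw [Set.indicator_of_mem (by exact hs), ← ENNReal.ofReal_mul hE0, ← enorm_eq_nnnorm,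
        ← ofReal_norm]
      refine ENNReal.ofReal_le_ofReal ((hA L lam D J hL0 hlam hj'.le Φ hΦs hΦ s a b ξ ζ).trans ?_)
      have hP := bilinearBound_nonneg J (s / L ^ 2)
      have hd3 : d = (d - 3) + 3 := by omega
      have hpow : bilinearBound J (s / L ^ 2) ^ d ≤
          (4 * (2 ^ J) ^ 2) ^ (d - 3) * bilinearBound J (s / L ^ 2) ^ 3 := by
        calc bilinearBound J (s / L ^ 2) ^ d
            = bilinearBound J (s / L ^ 2) ^ (d - 3) * bilinearBound J (s / L ^ 2) ^ 3 := by
              rw [← pow_add, ← hd3]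
          _ ≤ _ := by
              gcongr
              exact bilinearBound_le_sq J _
      rw [hE, mul_assoc _ ((4 * ((2 : ℝ) ^ J) ^ 2) ^ (d - 3))]
      gcongr
    · have hz : latSum d χ₀ Φ lam L s a b ξ ζ = 0 := by
        simp [latSum, hsupp s _ _ (not_lt.mp hs)]
      simp [hz]
  have hmeas : MeasurableSet {s : ℝ | |s| < L ^ (2 * γ)} :=
    measurableSet_lt (by fun_prop) (by fun_prop)
  calc _ ≤ ENNReal.ofReal E * ∫⁻ s in {s : ℝ | |s| < L ^ (2 * γ)},
          ENNReal.ofReal (bilinearBound J (s / L ^ 2) ^ 3) := by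
        refine (lintegral_mono hpt).trans_eq ?_
        rw [lintegral_indicator hmeas, lintegral_const_mul' _ _ ENNReal.ofReal_ne_top]
    _ ≤ ENNReal.ofReal E * ENNReal.ofReal (B * (lam * L) ^ 6) := by
        gcongr
        exact hB L lam J (by linarith) hlam hJ
    _ = ENNReal.ofReal (E * (B * (lam * L) ^ 6)) := (ENNReal.ofReal_mul hE0).symm
    _ ≤ _ := by
        apply ENNReal.ofReal_le_ofReal
        have e1 : lam ^ (4 * (d : ℝ)) = lam ^ (4 * d) := by
          rw [← Real.rpow_natCast]; push_cast; rfl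
        have e2 : L ^ (2 * (d : ℝ)) = L ^ (2 * d) := by
          rw [← Real.rpow_natCast]; push_cast; rfl
        rw [e1, e2]
        have h1 : (2 : ℝ) ^ J / L ≤ 4 * lam := by
          rw [div_le_iff₀ hL0]; linarith
        have hEle : E ≤ A * D * (4 * lam) ^ (2 * d) * (64 * (lam * L) ^ 2) ^ (d - 3) := by
          have h2 : 4 * ((2 : ℝ) ^ J) ^ 2 ≤ 64 * (lam * L) ^ 2 := by
            calc 4 * ((2 : ℝ) ^ J) ^ 2 ≤ 4 * (4 * (lam * L)) ^ 2 := by gcongr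
              _ = _ := by ring
          rw [hE]
          gcongr
        obtain ⟨m, rfl⟩ : ∃ m, d = m + 3 := ⟨d - 3, by omega⟩
        rw [Nat.add_sub_cancel] at hEle ⊢
        calc E * (B * (lam * L) ^ 6)
            ≤ A * D * (4 * lam) ^ (2 * (m + 3)) * (64 * (lam * L) ^ 2) ^ m *
                (B * (lam * L) ^ 6) := by gcongr
          _ = A * 4 ^ (2 * (m + 3)) * 64 ^ m * B * D * lam ^ (4 * (m + 3)) * L ^ (2 * (m + 3)) := by
              rw [mul_pow 4 lam, mul_pow 64, ← pow_mul, mul_pow lam L, mul_pow lam L]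
              ring
          _ ≤ _ := by
              gcongr
              exact le_max_right _ _
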